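/- For every integer k ≥ 2 and every n ∈ ℕ^ℕ, the set of extreme points of DF(n) is finite if and only if k = 2 or n is of rational type (n_r = 0 for all sufficiently large r). -/

import Mathlib

open Filter Topology
open scoped Classical

namespace BetaDF

/-- Digit sequences (elements of `Σ = {0,…,k−1}^ℕ` when all entries are `< k`). -/
abbrev Seq : Type := ℕ → ℕ

/-- Lexicographic (strict) order on digit sequences. -/
def seqLt (v w : Seq) : Prop := ∃ r, (∀ s, s < r → v s = w s) ∧ v r < w r

/-- Lexicographic order on digit sequences. -/
def seqLe (v w : Seq) : Prop := seqLt v w ∨ v = w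

/-- The shift map `σ`. -/
def shift (w : Seq) : Seq := fun r => w (r + 1)

/-- Membership in `Σ = {0,…,k−1}^ℕ`. -/
def InSigma (k : ℕ) (w : Seq) : Prop := ∀ r, w r < k

/-- A sequence is maximal if it is `≥` every element of its shift orbit. -/
def IsMaximal (w : Seq) : Prop := ∀ r, seqLe (shift^[r] w) w

/-- Number of occurrences of the digit `i` among the first `r` entries of `w`. -/
def digitCount (w : Seq) (i r : ℕ) : ℕ := ((Finset.range r).filter fun s => w s = i).card

/-- The ambient Euclidean space `ℝ^k`. -/
abbrev E (k : ℕ) : Type := EuclideanSpace ℝ (Fin k)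

/-- The `i`-th coordinate (with junk value `0` for `i ≥ k`). -/
def proj {k : ℕ} (α : E k) (i : ℕ) : ℝ := if h : i < k then α ⟨i, h⟩ else 0

/-- `w` has digit frequency vector `α`. -/
def HasDigitFreq (k : ℕ) (w : Seq) (α : E k) : Prop :=
  ∀ i, i < k →
    Tendsto (fun r => (digitCount w i r : ℝ) / (r : ℝ)) atTop (𝓝 (proj α i))

/-- The standard `(k−1)`-simplex `Δ`. -/
def simplex (k : ℕ) : Set (E k) := {α | (∀ i : Fin k, 0 ≤ α i) ∧ ∑ i, α i = 1}

/-- The face `F = {α ∈ Δ : α_{k−1} = 0}`. -/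
def faceF (k : ℕ) : Set (E k) := {α ∈ simplex k | proj α (k - 1) = 0}

/-- `Δ' = Δ ∖ F`. -/
def simplex' (k : ℕ) : Set (E k) := simplex k \ faceF k

/-- `J(α) = ⌊α₀/α_{k−1}⌋`. -/
noncomputable def Jfun {k : ℕ} (α : E k) : ℕ := ⌊proj α 0 / proj α (k - 1)⌋₊

/-- The map `K_n`. -/
noncomputable def Kmap {k : ℕ} (n : ℕ) (α : E k) : E k :=
  (WithLp.equiv 2 (Fin k → ℝ)).symm fun i =>
    if (i : ℕ) + 2 < k then proj α ((i : ℕ) + 1) / (1 - proj α 0)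
    else if (i : ℕ) + 2 = k then (proj α 0 - n * proj α (k - 1)) / (1 - proj α 0)
    else ((n + 1) * proj α (k - 1) - proj α 0) / (1 - proj α 0)

/-- The continued-fraction map `K : Δ' → Δ'`, `K(α) = K_{J(α)}(α)`. -/
noncomputable def Kstep {k : ℕ} (α : E k) : E k := Kmap (Jfun α) α

/-- The itinerary map `Φ(α)_r = J(K^r(α))`. -/
noncomputable def Phi {k : ℕ} (α : E k) : ℕ → ℕ := fun r => Jfun (Kstep^[r] α)

/-- The projective embedding `K_n^{-1} : Δ → Δ`. -/
noncomputable def Kinv {k : ℕ} (n : ℕ) (α : E k) : E k :=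
  (WithLp.equiv 2 (Fin k → ℝ)).symm fun i =>
    (if (i : ℕ) = 0 then (n + 1) * proj α (k - 2) + n * proj α (k - 1)
      else if (i : ℕ) + 1 = k then proj α (k - 2) + proj α (k - 1)
      else proj α ((i : ℕ) - 1)) /
      ((n + 1) * proj α (k - 2) + n * proj α (k - 1) + 1)

/-- `Υ_{n,r} = K_{n₀}^{-1} ∘ ⋯ ∘ K_{n_r}^{-1}`. -/
noncomputable def Ups {k : ℕ} (n : ℕ → ℕ) : ℕ → E k → E k
  | 0 => Kinv (n 0)
  | r + 1 => fun α => Ups n r (Kinv (n (r + 1)) α)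

/-- `A_{n,r} = Υ_{n,r}(Δ)`. -/
noncomputable def Anr (k : ℕ) (n : ℕ → ℕ) (r : ℕ) : Set (E k) := Ups n r '' simplex k

/-- `F_{n,r} = Υ_{n,r}(F)`. -/
noncomputable def Fnr (k : ℕ) (n : ℕ → ℕ) (r : ℕ) : Set (E k) := Ups n r '' faceF k

/-- Reverse-lexicographic strict order on `ℕ^ℕ`: `a < b` iff `a` exceeds `b`
at the first index where they differ. -/
def revLexLt (a b : ℕ → ℕ) : Prop := ∃ r, (∀ s, s < r → a s = b s) ∧ b r < a r

/-- The word to which the substitution `Λ_n` sends the digit `i`. -/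
def lamWord (k n i : ℕ) : List ℕ :=
  if i + 2 < k then [i + 1]
  else if i + 2 = k then (k - 1) :: List.replicate (n + 1) 0
  else (k - 1) :: List.replicate n 0

/-- The substitution `Λ_n : Σ → Σ`. -/
def lamSub (k n : ℕ) (w : Seq) : Seq := fun m =>
  (((List.range (m + 1)).map fun r => lamWord k n (w r)).flatten).getD m 0

/-- `Λ_{n,r} = Λ_{n₀} ∘ ⋯ ∘ Λ_{n_r}`. -/
def lamChain (k : ℕ) (n : ℕ → ℕ) : ℕ → Seq → Seq
  | 0 => lamSub k (n 0)
  | r + 1 => fun w => lamChain k n r (lamSub k (n (r + 1)) w)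

/-- `Λ_{n₀} ∘ ⋯ ∘ Λ_{n_{R−1}}` for a finite list of indices. -/
def lamList (k : ℕ) : List ℕ → Seq → Seq
  | [], w => w
  | a :: t, w => lamSub k a (lamList k t w)

/-- The constant sequence `(k−1)(k−1)(k−1)…`. -/
def topSeq (k : ℕ) : Seq := fun _ => k - 1

/-- The sequence `(k−1)000…`. -/
def baseSeq (k : ℕ) : Seq := fun m => if m = 0 then k - 1 else 0

/-- `S(n) = lim_{r→∞} Λ_{n,r}((k−1)(k−1)(k−1)…)` (limit in the product topology). -/
noncomputable def Sseq (k : ℕ) (n : ℕ → ℕ) : Seq :=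
  limUnder atTop fun r => lamChain k n r (topSeq k)

/-- The compactified itinerary space `N`: sequences with values in `ℕ∞` such that
all entries from the first `∞` onwards equal `∞`.  Elements with no `∞` entry
correspond to `ℕ^ℕ`; the others are the finite type elements `n₀…n_{R−1}∞`. -/
def NN : Type := {m : ℕ → ℕ∞ // ∀ r, m r = ⊤ → m (r + 1) = ⊤}

/-- Reverse-lexicographic strict order on `N` (`∞` counts as larger than every natural). -/
def nnLt (m n : NN) : Prop := ∃ r, (∀ s, s < r → m.1 s = n.1 s) ∧ n.1 r < m.1 r

/-- Reverse-lexicographic order on `N`. -/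
def nnLe (m n : NN) : Prop := nnLt m n ∨ m = n

/-- The element of `N` determined by an element of `ℕ^ℕ`. -/
def toNN (g : ℕ → ℕ) : NN := ⟨fun r => (g r : ℕ∞), fun r h => absurd h (by simp)⟩

/-- The itinerary `n₀ … n_{R−1} (n_R + 1) 0 0 0 …` (of rational type). -/
def ratSeq (f : ℕ → ℕ) (R : ℕ) : ℕ → ℕ := fun r =>
  if r < R then f r else if r = R then f R + 1 else 0

/-- The finite type element `n₀ … n_{R−1} n_R ∞` of `N`. -/
def finNN (f : ℕ → ℕ) (R : ℕ) : NN :=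
  ⟨fun r => if r ≤ R then (f r : ℕ∞) else ⊤, by
    intro r h
    show (if r + 1 ≤ R then ((f (r + 1) : ℕ∞)) else ⊤) = ⊤
    have h' : (if r ≤ R then ((f r : ℕ∞)) else ⊤) = ⊤ := h
    by_cases h1 : r ≤ R
    · rw [if_pos h1] at h'
      exact absurd h' (by simp)
    · rw [if_neg (by omega : ¬ r + 1 ≤ R)]⟩

/-- The extension of `S` to `N`. -/
noncomputable def SN (k : ℕ) (m : NN) : Seq :=
  if h : ∃ R, m.1 R = ⊤ then
    lamList k ((List.range (Nat.find h)).map fun r => (m.1 r).toNat) (baseSeq k)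
  else Sseq k fun r => (m.1 r).toNat

/-- The metric `d(m,n) = 2^{−X(m,n)}` on `N`, where
`X(m,n) = r + min(m₀+⋯+m_r, n₀+⋯+n_r)` and `r` is the first index where `m,n` differ. -/
noncomputable def dN (m n : NN) : ℝ :=
  if h : m = n then 0
  else
    have hex : ∃ r, m.1 r ≠ n.1 r := by
      by_contra hc
      push_neg at hc
      exact h (Subtype.ext (funext hc))
    (2 : ℝ) ^ (-(((Nat.find hex : ℕ) : ℤ) +
      ((min (∑ s ∈ Finset.range (Nat.find hex + 1), m.1 s)
            (∑ s ∈ Finset.range (Nat.find hex + 1), n.1 s)).toNat : ℤ)))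

/-- The symbolic β-shift `X(w)`. -/
def Xset (k : ℕ) (w : Seq) : Set Seq :=
  {v | InSigma k v ∧ ∀ r, seqLe (shift^[r] v) w}

/-- The digit frequency set `DF(w)` of the symbolic β-shift `X(w)`. -/
def DFw (k : ℕ) (w : Seq) : Set (E k) :=
  {α | α ∈ simplex k ∧ ∃ v ∈ Xset k w, HasDigitFreq k v α}

/-- `DF(n) = DF(S(n))` for `n ∈ ℕ^ℕ`. -/
noncomputable def DFn (k : ℕ) (n : ℕ → ℕ) : Set (E k) := DFw k (Sseq k n)

/-- `DF(n) = DF(S(n))` for `n ∈ N`. -/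
noncomputable def DFN (k : ℕ) (m : NN) : Set (E k) := DFw k (SN k m)

/-- The infimax map `I = S ∘ Φ` on `Δ'`, extended by `I(α) = (k−1)000…` on `F`. -/
noncomputable def Ifun (k : ℕ) (α : E k) : Seq :=
  if α ∈ simplex' k then Sseq k (Phi α) else baseSeq k

/-- The simplex `T_m = {α ∈ Δ : (m+1)α_{k−1} ≤ α₀}`. -/
def Tset (k m : ℕ) : Set (E k) :=
  {α ∈ simplex k | ((m : ℝ) + 1) * proj α (k - 1) ≤ proj α 0}

/-- The standard basis vector `e_i`. -/
noncomputable def evec (k i : ℕ) : E k :=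
  (WithLp.equiv 2 (Fin k → ℝ)).symm fun j => if (j : ℕ) = i then 1 else 0

/-- The rational extreme points
`FE(n) = {Υ_{n,s}(e_{k−2}) : n_{s+t} ≠ 0 for some 1 ≤ t ≤ k−2}`. -/
noncomputable def FEset (k : ℕ) (n : ℕ → ℕ) : Set (E k) :=
  {α | ∃ s, (∃ t, 1 ≤ t ∧ t ≤ k - 2 ∧ n (s + t) ≠ 0) ∧ α = Ups n s (evec k (k - 2))}

/-- The set `E(n)` of non-trivial extreme points of `DF(n)`:
extreme points other than `e₀,…,e_{k−2}`. -/
noncomputable def Eset (k : ℕ) (n : ℕ → ℕ) : Set (E k) :=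
  Set.extremePoints ℝ (DFn k n) \ {α | ∃ i, i ≤ k - 2 ∧ α = evec k i}

/-- The fiber `Φ^{-1}(n) ⊆ Δ'`. -/
noncomputable def PhiFiber (k : ℕ) (n : ℕ → ℕ) : Set (E k) :=
  {α ∈ simplex' k | Phi α = n}

/-- `f_β(x) = βx mod 1`. -/
noncomputable def fbeta (β x : ℝ) : ℝ := Int.fract (β * x)

/-- The digit sequence of the greedy β-expansion of `x`: `d_β(x)_r = ⌊β f_β^r(x)⌋`. -/
noncomputable def dbeta (β : ℝ) (x : ℝ) : Seq := fun r => ⌊β * (fbeta β)^[r] x⌋₊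

/-- The digit frequency set `DF(β)` of β-expansions of points of `[0,1]`. -/
noncomputable def DFbeta (k : ℕ) (β : ℝ) : Set (E k) :=
  {α | α ∈ simplex k ∧ ∃ x ∈ Set.Icc (0 : ℝ) 1, HasDigitFreq k (dbeta β x) α}

/-- The sequence `w_β`: if `d_β(1) = d₁…d_{r−1}d_r000…` with `d_r > 0` then `w_β`
is the infinite repetition of `d₁…d_{r−1}(d_r − 1)`; otherwise `w_β = d_β(1)`. -/
noncomputable def wbeta (β : ℝ) : Seq :=
  if h : ∃ r, dbeta β 1 r ≠ 0 ∧ ∀ s, r < s → dbeta β 1 s = 0 then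
    fun m =>
      if m % (Nat.find h + 1) = Nat.find h then dbeta β 1 (Nat.find h) - 1
      else dbeta β 1 (m % (Nat.find h + 1))
  else dbeta β 1

/-- `DF` extended to `[k−1,k]` by `DF(k−1) = F` and `DF(k) = Δ`. -/
noncomputable def DFext (k : ℕ) (β : ℝ) : Set (E k) :=
  if β ≤ (k : ℝ) - 1 then faceF k
  else if (k : ℝ) ≤ β then simplex k
  else DFbeta k β

/-- The mode-locking interval `I_{n₀…n_R}` determined by the word `f 0, …, f R`. -/
noncomputable def Iint (k : ℕ) (f : ℕ → ℕ) (R : ℕ) : Set ℝ :=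
  {β | (k : ℝ) - 1 < β ∧ β < k ∧
    seqLe (Sseq k (ratSeq f R)) (wbeta β) ∧ seqLe (wbeta β) (SN k (finNN f R))}

/-- The frequency vector of the first `s` digits of `w`. -/
noncomputable def freqVec (k : ℕ) (w : Seq) (s : ℕ) : E k :=
  (WithLp.equiv 2 (Fin k → ℝ)).symm fun i => (digitCount w (i : ℕ) s : ℝ) / (s : ℝ)


/-! ### Words -/

/-- Prefix of length `j` of a sequence. -/
def pre (w : Seq) (j : ℕ) : List ℕ := (List.range j).map w

/-- The substitution on finite words. -/
def lw (k m : ℕ) (l : List ℕ) : List ℕ := l.flatMap (lamWord k m)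

/-- Weight of a word. -/
def wt (f : ℕ → ℝ) (l : List ℕ) : ℝ := (l.map f).sum

/-- Pull back of a weight by the substitution. -/
def pull (k m : ℕ) (f : ℕ → ℝ) : ℕ → ℝ := fun i => wt f (lamWord k m i)

lemma wt_nil (f : ℕ → ℝ) : wt f [] = 0 := by simp [wt]
lemma wt_cons (f : ℕ → ℝ) (a : ℕ) (l : List ℕ) : wt f (a :: l) = f a + wt f l := by simp [wt]
lemma wt_append (f : ℕ → ℝ) (l l' : List ℕ) : wt f (l ++ l') = wt f l + wt f l' := by simp [wt]
lemma wt_replicate (f : ℕ → ℝ) (n a : ℕ) : wt f (List.replicate n a) = n * f a := by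
  simp [wt]
lemma wt_singleton (f : ℕ → ℝ) (a : ℕ) : wt f [a] = f a := by simp [wt]

lemma lw_nil (k m : ℕ) : lw k m [] = [] := rfl
lemma lw_cons (k m a : ℕ) (l : List ℕ) : lw k m (a :: l) = lamWord k m a ++ lw k m l := by
  simp [lw]
lemma lw_append (k m : ℕ) (l l' : List ℕ) : lw k m (l ++ l') = lw k m l ++ lw k m l' := by
  simp [lw]
lemma lw_singleton (k m a : ℕ) : lw k m [a] = lamWord k m a := by simp [lw]

lemma wt_lw (k m : ℕ) (f : ℕ → ℝ) (l : List ℕ) : wt f (lw k m l) = wt (pull k m f) l := by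
  induction l with
  | nil => simp [lw_nil, wt_nil]
  | cons a l ih => rw [lw_cons, wt_append, wt_cons, ih]; rfl

lemma pre_zero (w : Seq) : pre w 0 = [] := rfl
lemma pre_succ (w : Seq) (j : ℕ) : pre w (j + 1) = pre w j ++ [w j] := by
  simp [pre, List.range_succ]
lemma pre_length (w : Seq) (j : ℕ) : (pre w j).length = j := by simp [pre]

/-- First letter and number of zeros of the words. -/
lemma lamWord_eq (k m i : ℕ) : ∃ z, z ≤ m + 1 ∧
    lamWord k m i = (if i + 2 < k then i + 1 else k - 1) :: List.replicate z 0 := by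
  unfold lamWord
  split_ifs with h1 h2
  · exact ⟨0, by omega, rfl⟩
  · exact ⟨m + 1, le_rfl, rfl⟩
  · exact ⟨m, by omega, rfl⟩

lemma lw_pre_succ (k m : ℕ) (w : Seq) (j : ℕ) :
    lw k m (pre w (j + 1)) = lw k m (pre w j) ++ lamWord k m (w j) := by
  rw [pre_succ, lw_append, lw_singleton]

lemma lamWord_pos (k m i : ℕ) : 0 < (lamWord k m i).length := by
  obtain ⟨z, _, h⟩ := lamWord_eq k m i
  simp [h]

lemma lw_pre_le (k m : ℕ) (w : Seq) (j : ℕ) : j ≤ (lw k m (pre w j)).length := by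
  induction j with
  | zero => simp
  | succ j ih =>
    rw [lw_pre_succ, List.length_append]
    have := lamWord_pos k m (w j)
    omega

lemma lw_pre_prefix (k m : ℕ) (w : Seq) (i j : ℕ) (h : i ≤ j) :
    lw k m (pre w i) <+: lw k m (pre w j) := by
  induction j, h using Nat.le_induction with
  | base => exact List.prefix_rfl
  | succ j _ ih => rw [lw_pre_succ]; exact ih.trans (List.prefix_append _ _)

lemma lamSub_eq (k m : ℕ) (w : Seq) (p : ℕ) :
    lamSub k m w p = (lw k m (pre w (p + 1))).getD p 0 := by
  simp only [lamSub, lw, pre, List.flatMap, List.map_map]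
  rfl

lemma prefix_getD {l l' : List ℕ} (h : l <+: l') (p : ℕ) (hp : p < l.length) :
    l'.getD p 0 = l.getD p 0 := by
  obtain ⟨t, rfl⟩ := h
  simp [List.getD, List.getElem?_append_left hp]

lemma lamSub_get (k m : ℕ) (w : Seq) (p j : ℕ) (h : p < (lw k m (pre w j)).length) :
    lamSub k m w p = (lw k m (pre w j)).getD p 0 := by
  rw [lamSub_eq]
  have h2 := lw_pre_le k m w (p + 1)
  rcases le_total j (p + 1) with h1 | h1
  · exact prefix_getD (lw_pre_prefix k m w _ _ h1) p h
  · exact (prefix_getD (lw_pre_prefix k m w _ _ h1) p (by omega)).symm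

/-- Position of the image of the `j`-th letter. -/
def pos (k m : ℕ) (w : Seq) (j : ℕ) : ℕ := (lw k m (pre w j)).length

lemma pre_ext (w : Seq) (l : List ℕ) (h : ∀ p, p < l.length → w p = l.getD p 0) :
    pre w l.length = l := by
  apply List.ext_getElem
  · simp [pre]
  · intro p h1 h2
    simp only [pre, List.getElem_map, List.getElem_range]
    rw [h p h2, List.getD_eq_getElem _ _ h2]

lemma pre_lamSub (k m : ℕ) (w : Seq) (j : ℕ) :
    pre (lamSub k m w) (pos k m w j) = lw k m (pre w j) :=
  pre_ext _ _ fun p hp => lamSub_get k m w p j hp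

lemma pos_succ (k m : ℕ) (w : Seq) (j : ℕ) :
    pos k m w (j + 1) = pos k m w j + (lamWord k m (w j)).length := by
  simp [pos, lw_pre_succ]

lemma lamSub_pos (k m : ℕ) (w : Seq) (j t : ℕ) (ht : t < (lamWord k m (w j)).length) :
    lamSub k m w (pos k m w j + t) = (lamWord k m (w j)).getD t 0 := by
  rw [lamSub_get k m w _ (j + 1)]
  · rw [lw_pre_succ]
    simp [List.getD, pos, List.getElem?_append_right]
  · rw [lw_pre_succ]; simp [pos, ht]

lemma lamSub_pos_zero (k m : ℕ) (w : Seq) (j : ℕ) :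
    lamSub k m w (pos k m w j) = if w j + 2 < k then w j + 1 else k - 1 := by
  have := lamSub_pos k m w j 0 (lamWord_pos _ _ _)
  obtain ⟨z, _, h⟩ := lamWord_eq k m (w j)
  rw [add_zero] at this
  rw [this, h]
  simp

lemma lamSub_pos_succ (k m : ℕ) (w : Seq) (j t : ℕ) (ht : t + 1 < (lamWord k m (w j)).length) :
    lamSub k m w (pos k m w j + (t + 1)) = 0 := by
  rw [lamSub_pos k m w j _ ht]
  obtain ⟨z, _, h⟩ := lamWord_eq k m (w j)
  rw [h] at ht ⊢
  simp at ht
  simp [ht]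

lemma exists_pos (k m : ℕ) (w : Seq) (p : ℕ) :
    ∃ j t, t < (lamWord k m (w j)).length ∧ p = pos k m w j + t := by
  induction p with
  | zero => exact ⟨0, 0, lamWord_pos _ _ _, by simp [pos, pre_zero, lw_nil]⟩
  | succ p ih =>
    obtain ⟨j, t, ht, rfl⟩ := ih
    by_cases h : t + 1 < (lamWord k m (w j)).length
    · exact ⟨j, t + 1, h, by omega⟩
    · refine ⟨j + 1, 0, lamWord_pos _ _ _, ?_⟩
      rw [pos_succ]; omega

lemma lamSub_congr (k m : ℕ) (v w : Seq) (p : ℕ) (h : ∀ i, i ≤ p → v i = w i) :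
    lamSub k m v p = lamSub k m w p := by
  rw [lamSub_eq, lamSub_eq]
  congr 2
  simp only [pre]
  apply List.map_congr_left
  intro a ha
  exact h a (by simp at ha; omega)

/-- Digits below `k`. -/
def Dig (k : ℕ) (l : List ℕ) : Prop := ∀ a ∈ l, a < k

lemma lamWord_dig (k m i : ℕ) (hk : 2 ≤ k) : Dig k (lamWord k m i) := by
  obtain ⟨z, _, h⟩ := lamWord_eq k m i
  intro a ha
  rw [h] at ha
  rcases List.mem_cons.1 ha with rfl | h'
  · split_ifs <;> omega
  · have := List.eq_of_mem_replicate h'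
    omega

lemma lw_dig (k m : ℕ) (l : List ℕ) (hk : 2 ≤ k) : Dig k (lw k m l) := by
  intro a ha
  simp only [lw, List.mem_flatMap] at ha
  obtain ⟨b, _, hb⟩ := ha
  exact lamWord_dig k m b hk a hb

lemma lamSub_dig (k m : ℕ) (w : Seq) (hk : 2 ≤ k) : InSigma k (lamSub k m w) := by
  intro p
  have h := lw_pre_le k m w (p + 1)
  rw [lamSub_eq, List.getD_eq_getElem _ _ (by omega)]
  exact lw_dig k m _ hk _ (List.getElem_mem _)

/-! ### Upper bound: blocks -/

/-- The weight is nonnegative on all blocks of `w`. -/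
def Blk (f : ℕ → ℝ) (w : Seq) : Prop := ∀ j d, d < w j → 0 ≤ wt f (pre w j) + f d

lemma blk_step_aux (k m : ℕ) (hk : 2 ≤ k) (f : ℕ → ℝ) (w : Seq) (hw : InSigma k w)
    (hw0 : w 0 = k - 1) (h0 : 0 ≤ f 0) (hB : Blk (pull k m f) w) (j : ℕ) :
    0 ≤ wt (pull k m f) (pre w j) + f 0 := by
  induction j with
  | zero => simp [pre_zero, wt_nil, h0]
  | succ j ih =>
    rw [pre_succ, wt_append, wt_singleton]
    by_cases h : w j = k - 1
    · have h1 := hB j (k - 2) (by omega)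
      have h2 : pull k m f (k - 2) = pull k m f (k - 1) + f 0 := by
        simp only [pull, lamWord]
        rw [if_neg (by omega), if_pos (by omega), if_neg (by omega), if_neg (by omega)]
        rw [wt_cons, wt_cons, wt_replicate, wt_replicate]
        push_cast
        ring
      rw [h]
      linarith
    · have h1 := hB 0 (w j) (by have := hw j; omega)
      simp [pre_zero, wt_nil] at h1
      linarith

lemma blk_step (k m : ℕ) (hk : 2 ≤ k) (f : ℕ → ℝ) (w : Seq) (hw : InSigma k w)
    (hw0 : w 0 = k - 1) (h0 : 0 ≤ f 0) (hB : Blk (pull k m f) w) :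
    Blk f (lamSub k m w) ∧ ∃ C : ℝ, ∀ j, -C ≤ wt f (pre (lamSub k m w) j) := by
  have aux := blk_step_aux k m hk f w hw hw0 h0 hB
  constructor
  · intro p d hd
    obtain ⟨j, t, ht, rfl⟩ := exists_pos k m w p
    cases t with
    | succ t => rw [lamSub_pos_succ k m w j t ht] at hd; omega
    | zero =>
      rw [add_zero] at hd ⊢
      rw [pre_lamSub, wt_lw]
      rw [lamSub_pos_zero] at hd
      cases d with
      | zero => exact aux j
      | succ d =>
        have h1 : d + 2 < k ∧ d < w j := by
          have := hw j
          split_ifs at hd <;> omega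
        have h2 := hB j d h1.2
        have h3 : pull k m f d = f (d + 1) := by
          simp only [pull, lamWord]
          rw [if_pos h1.1, wt_singleton]
        rw [h3] at h2
        exact h2
  · refine ⟨f 0 + ∑ i ∈ Finset.range k, |f i|, fun p => ?_⟩
    obtain ⟨j, t, ht, rfl⟩ := exists_pos k m w p
    have hs : 0 ≤ ∑ i ∈ Finset.range k, |f i| := Finset.sum_nonneg fun _ _ => abs_nonneg _
    have key : ∀ t, t < (lamWord k m (w j)).length →
        -(f 0 + ∑ i ∈ Finset.range k, |f i|) ≤
          wt f (pre (lamSub k m w) (pos k m w j + t)) := by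
      intro t
      induction t with
      | zero =>
        intro _
        rw [add_zero, pre_lamSub, wt_lw]
        linarith [aux j]
      | succ t ih =>
        intro ht
        have ih := ih (by omega)
        rw [← add_assoc, pre_succ, wt_append, wt_singleton]
        cases t with
        | zero =>
          rw [add_zero, pre_lamSub, wt_lw]
          have h1 : lamSub k m w (pos k m w j) ∈ Finset.range k :=
            Finset.mem_range.2 (lamSub_dig k m w hk _)
          have h2 := Finset.single_le_sum (f := fun i => |f i|) (fun _ _ => abs_nonneg _) h1
          have h3 := neg_abs_le (f (lamSub k m w (pos k m w j)))
          linarith [aux j]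
        | succ t =>
          rw [lamSub_pos_succ k m w j t (by omega)]
          linarith
    exact key t ht

lemma shift_iter (v : Seq) (r i : ℕ) : shift^[r] v i = v (r + i) := by
  induction r generalizing v with
  | zero => simp
  | succ r ih =>
    rw [Function.iterate_succ_apply, ih]
    simp only [shift]
    congr 1
    omega

/-- Weight of a factor. -/
lemma blk_factor (f : ℕ → ℝ) (w v : Seq) (hB : Blk f w) (C : ℝ)
    (hC : ∀ j, -C ≤ wt f (pre w j)) (hv : ∀ r, seqLe (shift^[r] v) w) (L : ℕ) :
    ∀ r, -C ≤ wt f ((List.range L).map fun i => v (r + i)) := by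
  induction L using Nat.strong_induction_on with
  | _ L ih =>
    intro r
    by_cases h : ∃ j, j < L ∧ v (r + j) ≠ w j
    · have hj := Nat.find_spec h
      have hmin := fun i => Nat.find_min h (m := i)
      set j := Nat.find h
      have hlt : v (r + j) < w j := by
        rcases hv r with ⟨s, hs1, hs2⟩ | heq
        · rw [shift_iter] at hs2
          rcases lt_trichotomy s j with h1 | h1 | h1
          · exact absurd ⟨h1.trans hj.1, hs2.ne⟩ (hmin s h1)
          · rwa [h1] at hs2
          · have := hs1 j h1
            rw [shift_iter] at this
            exact absurd this hj.2
        · have := congrFun heq j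
          rw [shift_iter] at this
          exact absurd this hj.2
      have h1 := hB j _ hlt
      have h2 := ih (L - (j + 1)) (by omega) (r + (j + 1))
      have h3 : ((List.range L).map fun i => v (r + i)) =
          pre w j ++ ([v (r + j)] ++ (List.range (L - (j + 1))).map fun i => v (r + (j + 1) + i)) := by
        have : L = (j + 1) + (L - (j + 1)) := by omega
        conv_lhs => rw [this, List.range_add, List.map_append, List.range_succ, List.map_append]
        rw [List.append_assoc]
        congr 1
        · apply List.map_congr_left
          intro a ha
          have ha := List.mem_range.1 ha
          by_contra hne
          exact hmin a ha ⟨ha.trans hj.1, hne⟩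
        · congr 1
          rw [List.map_map]
          apply List.map_congr_left
          intro a _
          simp [add_assoc]
      rw [h3, wt_append, wt_append, wt_singleton]
      linarith
    · push Not at h
      have : ((List.range L).map fun i => v (r + i)) = pre w L := by
        apply List.map_congr_left
        intro a ha
        exact h a (List.mem_range.1 ha)
      rw [this]
      exact hC L

lemma digitCount_eq (w : Seq) (i r : ℕ) : digitCount w i r = (pre w r).count i := by
  induction r with
  | zero => simp [digitCount, pre_zero]
  | succ r ih =>
    rw [pre_succ, List.count_append, ← ih]
    simp only [digitCount, Finset.range_add_one, Finset.filter_insert]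
    by_cases h : w r = i
    · simp [h]
    · simp [h]

lemma wt_eq_sum (k : ℕ) (f : ℕ → ℝ) (l : List ℕ) (hl : Dig k l) :
    wt f l = ∑ i : Fin k, f i * (l.count (i : ℕ) : ℝ) := by
  induction l with
  | nil => simp [wt_nil]
  | cons a l ih =>
    rw [wt_cons, ih fun b hb => hl b (List.mem_cons_of_mem _ hb)]
    have ha : a < k := hl a List.mem_cons_self
    simp only [List.count_cons]
    push_cast
    simp only [mul_add, Finset.sum_add_distrib]
    rw [add_comm]
    congr 1
    rw [Finset.sum_eq_single (⟨a, ha⟩ : Fin k)]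
    · simp
    · intro b _ hb
      have : a ≠ (b : ℕ) := fun h => hb (Fin.ext h.symm)
      simp [this]
    · simp

lemma pre_dig (k : ℕ) (w : Seq) (hw : InSigma k w) (j : ℕ) : Dig k (pre w j) := by
  intro a ha
  simp only [pre, List.mem_map] at ha
  obtain ⟨b, _, rfl⟩ := ha
  exact hw b

lemma proj_fin {k : ℕ} (α : E k) (i : Fin k) : proj α (i : ℕ) = α i := by
  simp [proj]

lemma freq_nonneg (k : ℕ) (f : ℕ → ℝ) (w : Seq) (hB : Blk f w) (C : ℝ)
    (hC : ∀ j, -C ≤ wt f (pre w j)) (α : E k) (hα : α ∈ DFw k w) :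
    0 ≤ ∑ i : Fin k, f i * α i := by
  obtain ⟨_, v, ⟨hv1, hv2⟩, hf⟩ := hα
  have h1 : Tendsto (fun r : ℕ => ∑ i : Fin k, f i * ((digitCount v i r : ℝ) / r)) atTop
      (𝓝 (∑ i : Fin k, f i * α i)) := by
    apply tendsto_finsetSum
    intro i _
    have := hf i i.2
    rw [proj_fin] at this
    exact this.const_mul _
  have h2 : Tendsto (fun r : ℕ => -C / (r : ℝ)) atTop (𝓝 0) :=
    tendsto_const_div_atTop_nhds_zero_nat _
  refine le_of_tendsto_of_tendsto h2 h1 (Eventually.of_forall fun r => ?_)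
  have h3 := blk_factor f w v hB C hC hv2 r 0
  have h4 : ((List.range r).map fun i => v (0 + i)) = pre v r := by simp [pre]
  rw [h4, wt_eq_sum k f _ (pre_dig k v hv1 r)] at h3
  have h5 : ∑ i : Fin k, f i * ((digitCount v i r : ℝ) / r) =
      (∑ i : Fin k, f i * ((pre v r).count (i : ℕ) : ℝ)) / r := by
    rw [Finset.sum_div]
    refine Finset.sum_congr rfl fun i _ => ?_
    rw [digitCount_eq, mul_div_assoc]
  simp only [h5]
  gcongr

/-! ### The sequence `S(n)` -/

/-- Tail of a sequence of indices. -/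
def tl (n : ℕ → ℕ) : ℕ → ℕ := fun r => n (r + 1)

lemma lamChain_succ (k : ℕ) (n : ℕ → ℕ) (r : ℕ) (w : Seq) :
    lamChain k n (r + 1) w = lamSub k (n 0) (lamChain k (tl n) r w) := by
  induction r generalizing w with
  | zero => rfl
  | succ r ih =>
    show lamChain k n (r + 1) (lamSub k (n (r + 2)) w) = _
    rw [ih]
    rfl

lemma lamSub_first (k m : ℕ) (w : Seq) (h : w 0 = k - 1) :
    lamSub k m w 0 = k - 1 := by
  have h1 := lamSub_pos_zero k m w 0
  have h2 : pos k m w 0 = 0 := by simp [pos, pre_zero, lw_nil]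
  rw [h2, h, if_neg (by omega)] at h1
  exact h1

lemma lamWord_last (k m : ℕ) (hk : 2 ≤ k) :
    lamWord k m (k - 1) = (k - 1) :: List.replicate m 0 := by
  simp only [lamWord]
  rw [if_neg (by omega), if_neg (by omega)]

lemma lamSub_zero_top (k : ℕ) (hk : 2 ≤ k) : lamSub k 0 (topSeq k) = topSeq k := by
  funext p
  obtain ⟨j, t, ht, rfl⟩ := exists_pos k 0 (topSeq k) p
  have h1 : (lamWord k 0 (topSeq k j)).length = 1 := by
    have htop : topSeq k j = k - 1 := rfl
    rw [htop, lamWord_last k 0 hk]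
    simp
  have h2 : t = 0 := by omega
  subst h2
  rw [add_zero, lamSub_pos_zero]
  have htop : ∀ j, topSeq k j = k - 1 := fun _ => rfl
  rw [htop, htop, if_neg (by omega)]

/-- If two sequences starting with `k-1` agree up to `L`, their images do, and further if `m ≠ 0`. -/
lemma lamSub_agree (k m : ℕ) (hk : 2 ≤ k) (v w : Seq) (L : ℕ) (hv : v 0 = k - 1)
    (h : ∀ i, i < L + 1 → v i = w i) :
    ∀ i, i < L + 1 + (if m = 0 then 0 else 1) → lamSub k m v i = lamSub k m w i := by
  have hp : pre v (L + 1) = pre w (L + 1) := by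
    apply List.map_congr_left
    intro a ha
    exact h a (List.mem_range.1 ha)
  have hlen : ∀ L, L + 1 + (if m = 0 then 0 else 1) ≤ (lw k m (pre v (L + 1))).length := by
    intro L
    induction L with
    | zero =>
      rw [pre_succ, pre_zero, List.nil_append, lw_singleton, hv, lamWord_last k m hk]
      simp
      split_ifs <;> omega
    | succ L ih =>
      rw [lw_pre_succ, List.length_append]
      have := lamWord_pos k m (v (L + 1))
      omega
  intro i hi
  have := hlen L
  rw [lamSub_get k m v i (L + 1) (by omega), lamSub_get k m w i (L + 1) (by rw [← hp]; omega), hp]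

lemma lamChain_agree (k : ℕ) (hk : 2 ≤ k) (n : ℕ → ℕ) (r : ℕ) (v w : Seq)
    (hv : v 0 = k - 1) (hw : w 0 = k - 1) :
    lamChain k n r v 0 = k - 1 ∧
    ∀ i, i < 1 + ∑ s ∈ Finset.range (r + 1), (if n s = 0 then 0 else 1) →
      lamChain k n r v i = lamChain k n r w i := by
  induction r generalizing n with
  | zero =>
    refine ⟨lamSub_first k _ v hv, ?_⟩
    intro i hi
    refine lamSub_agree k (n 0) hk v w 0 hv ?_ i (by simpa using hi)
    intro i hi
    have : i = 0 := by omega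
    rw [this, hv, hw]
  | succ r ih =>
    obtain ⟨h1, h2⟩ := ih (tl n)
    rw [lamChain_succ, lamChain_succ]
    refine ⟨lamSub_first k _ _ h1, ?_⟩
    intro i hi
    refine lamSub_agree k (n 0) hk _ _ (∑ s ∈ Finset.range (r + 1), (if tl n s = 0 then 0 else 1))
      h1 ?_ i ?_
    · intro i hi
      exact h2 i (by omega)
    · rw [Finset.sum_range_succ'] at hi
      have e : (∑ s ∈ Finset.range (r + 1), (if tl n s = 0 then 0 else 1)) =
        ∑ s ∈ Finset.range (r + 1), (if n (s + 1) = 0 then 0 else 1) := rfl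
      omega

lemma lamChain_stab (k : ℕ) (hk : 2 ≤ k) (n : ℕ → ℕ) (p : ℕ) :
    ∃ R, ∀ r, R ≤ r → lamChain k n r (topSeq k) p = lamChain k n R (topSeq k) p := by
  have step : ∀ R, (∀ r, R ≤ r → n (r + 1) = 0 ∨
      p < 1 + ∑ s ∈ Finset.range (r + 1), (if n s = 0 then 0 else 1)) →
      ∀ r, R ≤ r → lamChain k n r (topSeq k) p = lamChain k n R (topSeq k) p := by
    intro R hR r hr
    induction r, hr using Nat.le_induction with
    | base => rfl
    | succ r hr ih =>
      rw [← ih]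
      show lamChain k n r (lamSub k (n (r + 1)) (topSeq k)) p = _
      rcases hR r hr with h | h
      · rw [h, lamSub_zero_top k hk]
      · exact (lamChain_agree k hk n r _ _ (lamSub_first k _ _ rfl) rfl).2 p h
  by_cases h : ∃ R, p < 1 + ∑ s ∈ Finset.range (R + 1), (if n s = 0 then 0 else 1)
  · obtain ⟨R, hR⟩ := h
    refine ⟨R, step R fun r hr => Or.inr (hR.trans_le ?_)⟩
    gcongr
  · push Not at h
    -- finitely many nonzero entries
    have hfin : ∃ R, ∀ r, R ≤ r → n r = 0 := by
      by_contra hc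
      push Not at hc
      have : ∀ q, ∃ R, q ≤ ∑ s ∈ Finset.range (R + 1), (if n s = 0 then 0 else 1) := by
        intro q
        induction q with
        | zero => exact ⟨0, Nat.zero_le _⟩
        | succ q ih =>
          obtain ⟨R, hR⟩ := ih
          obtain ⟨r, hr, hr0⟩ := hc (R + 1)
          refine ⟨r, ?_⟩
          rw [Finset.sum_range_succ, if_neg hr0]
          have : ∑ s ∈ Finset.range (R + 1), (if n s = 0 then 0 else 1) ≤
              ∑ s ∈ Finset.range r, (if n s = 0 then 0 else 1) := by gcongr
          omega
      obtain ⟨R, hR⟩ := this p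
      have := h R
      omega
    obtain ⟨R, hR⟩ := hfin
    exact ⟨R, step R fun r hr => Or.inl (hR _ (by omega))⟩

lemma Sseq_tendsto (k : ℕ) (hk : 2 ≤ k) (n : ℕ → ℕ) :
    Tendsto (fun r => lamChain k n r (topSeq k)) atTop (𝓝 (Sseq k n)) := by
  choose R hR using lamChain_stab k hk n
  have : Tendsto (fun r => lamChain k n r (topSeq k)) atTop
      (𝓝 (fun p => lamChain k n (R p) (topSeq k) p)) := by
    rw [tendsto_pi_nhds]
    intro p
    exact tendsto_const_nhds.congr' (eventually_atTop.2 ⟨R p, fun r hr => (hR p r hr).symm⟩)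
  exact tendsto_nhds_limUnder ⟨_, this⟩

lemma Sseq_eventually (k : ℕ) (hk : 2 ≤ k) (n : ℕ → ℕ) (p : ℕ) :
    ∀ᶠ r in atTop, lamChain k n r (topSeq k) p = Sseq k n p := by
  have h := tendsto_pi_nhds.1 (Sseq_tendsto k hk n) p
  rw [nhds_discrete, tendsto_pure] at h
  exact h

lemma Sseq_rec (k : ℕ) (hk : 2 ≤ k) (n : ℕ → ℕ) :
    Sseq k n = lamSub k (n 0) (Sseq k (tl n)) := by
  funext p
  have h1 := (tendsto_add_atTop_nat 1).eventually (Sseq_eventually k hk n p)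
  have h2 : ∀ᶠ r in atTop, ∀ i ∈ Finset.range (p + 1),
      lamChain k (tl n) r (topSeq k) i = Sseq k (tl n) i :=
    (Filter.eventually_all_finset _).2 fun i _ => Sseq_eventually k hk (tl n) i
  obtain ⟨r, hr1, hr2⟩ := (h1.and h2).exists
  rw [← hr1, lamChain_succ]
  exact lamSub_congr _ _ _ _ _ fun i hi => hr2 i (Finset.mem_range.2 (by omega))

lemma Sseq_first (k : ℕ) (hk : 2 ≤ k) (n : ℕ → ℕ) : Sseq k n 0 = k - 1 := by
  obtain ⟨r, hr⟩ := (Sseq_eventually k hk n 0).exists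
  rw [← hr]
  exact (lamChain_agree k hk n r (topSeq k) (topSeq k) rfl rfl).1

lemma Sseq_dig (k : ℕ) (hk : 2 ≤ k) (n : ℕ → ℕ) : InSigma k (Sseq k n) := by
  rw [Sseq_rec k hk]
  exact lamSub_dig _ _ _ hk

lemma Sseq_zero (k : ℕ) (hk : 2 ≤ k) (n : ℕ → ℕ) (h : ∀ r, n r = 0) : Sseq k n = topSeq k := by
  have h1 : ∀ r, lamChain k n r (topSeq k) = topSeq k := by
    intro r
    induction r with
    | zero => simp [lamChain, h, lamSub_zero_top k hk]
    | succ r ih => simp only [lamChain, h, lamSub_zero_top k hk, ih]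
  funext p
  obtain ⟨r, hr⟩ := (Sseq_eventually k hk n p).exists
  rw [← hr, h1]

/-! ### Iterated substitutions on words -/

/-- Iterated substitution on words. -/
def lwN (k : ℕ) : (ℕ → ℕ) → ℕ → List ℕ → List ℕ
  | _, 0, l => l
  | n, R + 1, l => lw k (n 0) (lwN k (tl n) R l)

lemma wt_congr (k : ℕ) (f g : ℕ → ℝ) (l : List ℕ) (hl : Dig k l) (h : ∀ i, i < k → f i = g i) :
    wt f l = wt g l := by
  unfold wt
  congr 1
  apply List.map_congr_left
  intro a ha
  exact h a (hl a ha)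

lemma wt_nonneg (k : ℕ) (f : ℕ → ℝ) (l : List ℕ) (hl : Dig k l) (h : ∀ i, i < k → 0 ≤ f i) :
    0 ≤ wt f l := by
  apply List.sum_nonneg
  intro x hx
  obtain ⟨a, ha, rfl⟩ := List.mem_map.1 hx
  exact h a (hl a ha)

lemma lwN_dig (k : ℕ) (hk : 2 ≤ k) (n : ℕ → ℕ) (R : ℕ) (l : List ℕ) (hl : Dig k l) :
    Dig k (lwN k n R l) := by
  cases R with
  | zero => exact hl
  | succ R => exact lw_dig _ _ _ hk

lemma lwN_append (k : ℕ) (n : ℕ → ℕ) (R : ℕ) (l l' : List ℕ) :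
    lwN k n R (l ++ l') = lwN k n R l ++ lwN k n R l' := by
  induction R generalizing n with
  | zero => rfl
  | succ R ih => simp only [lwN, ih, lw_append]

lemma lwN_nil (k : ℕ) (n : ℕ → ℕ) (R : ℕ) : lwN k n R [] = [] := by
  induction R generalizing n with
  | zero => rfl
  | succ R ih => simp only [lwN, ih, lw_nil]

lemma wt_lwN (k : ℕ) (n : ℕ → ℕ) (R : ℕ) (f : ℕ → ℝ) (l : List ℕ) :
    wt f (lwN k n R l) = wt (fun i => wt f (lwN k n R [i])) l := by
  induction l with
  | nil => simp [lwN_nil, wt_nil]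
  | cons a l ih =>
    have : a :: l = [a] ++ l := rfl
    rw [this, lwN_append, wt_append, ih, wt_append, wt_singleton]

lemma lw_ne_nil (k m : ℕ) (l : List ℕ) (h : l ≠ []) : lw k m l ≠ [] := by
  cases l with
  | nil => exact absurd rfl h
  | cons a l =>
    have := lamWord_pos k m a
    rw [lw_cons]
    intro h'
    simp [(List.append_eq_nil_iff.1 h').1] at this

lemma lwN_ne_nil (k : ℕ) (n : ℕ → ℕ) (R : ℕ) (l : List ℕ) (h : l ≠ []) : lwN k n R l ≠ [] := by
  induction R generalizing n with
  | zero => exact h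
  | succ R ih => exact lw_ne_nil _ _ _ (ih _)

lemma blk_S (k : ℕ) (hk : 2 ≤ k) (R : ℕ) (n : ℕ → ℕ) (f : ℕ → ℝ)
    (h0 : ∀ j, j < R → 0 ≤ wt f (lwN k n j [0]))
    (h1 : ∀ i, i < k → 0 ≤ wt f (lwN k n R [i])) : Blk f (Sseq k n) := by
  induction R generalizing n f with
  | zero =>
    have h2 : ∀ i, i < k → 0 ≤ f i := fun i hi => by
      have := h1 i hi
      simpa [lwN, wt_singleton] using this
    intro j d hd
    have := wt_nonneg k f _ (pre_dig k _ (Sseq_dig k hk n) j) h2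
    have := h2 d (hd.trans (Sseq_dig k hk n j))
    linarith
  | succ R ih =>
    rw [Sseq_rec k hk]
    refine (blk_step k (n 0) hk f _ (Sseq_dig k hk _) (Sseq_first k hk _) ?_ ?_).1
    · simpa [lwN, wt_singleton] using h0 0 (by omega)
    · apply ih
      · intro j hj
        rw [← wt_lw]
        exact h0 (j + 1) (by omega)
      · intro i hi
        rw [← wt_lw]
        exact h1 i hi

/-- Upper bound for `DF(n)`. -/
lemma upper (k : ℕ) (hk : 2 ≤ k) (R : ℕ) (n : ℕ → ℕ) (f : ℕ → ℝ)
    (h0 : ∀ j, j < R + 1 → 0 ≤ wt f (lwN k n j [0]))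
    (h1 : ∀ i, i < k → 0 ≤ wt f (lwN k n (R + 1) [i])) (α : E k) (hα : α ∈ DFn k n) :
    0 ≤ ∑ i : Fin k, f i * α i := by
  have hB : Blk (pull k (n 0) f) (Sseq k (tl n)) := by
    apply blk_S k hk R
    · intro j hj
      rw [← wt_lw]
      exact h0 (j + 1) (by omega)
    · intro i hi
      rw [← wt_lw]
      exact h1 i hi
  obtain ⟨h2, C, hC⟩ := blk_step k (n 0) hk f _ (Sseq_dig k hk _) (Sseq_first k hk (tl n))
    (by simpa [lwN, wt_singleton] using h0 0 (by omega)) hB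
  rw [← Sseq_rec k hk] at h2 hC
  exact freq_nonneg k f _ h2 C hC α hα

/-! ### Lower bound: good words -/

/-- Strictly smaller than `w` at some letter of `l`. -/
def LtP (l : List ℕ) (w : Seq) : Prop := ∃ j d t, l = pre w j ++ d :: t ∧ d < w j

/-- All suffixes are smaller than `w` or prefixes of `w`. -/
def Good (w : Seq) (u : List ℕ) : Prop := ∀ s, s <:+ u → LtP s w ∨ ∃ j, s = pre w j

/-- Words obtained from images of words of `B` by inserting zeros. -/
inductive Gam (k m : ℕ) (B : List ℕ → Prop) : List ℕ → Prop
  | base (a : List ℕ) : B a → Gam k m B (lw k m a)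
  | ins (a u : List ℕ) : B a → Gam k m B u → Gam k m B (lw k m a ++ 0 :: u)

/-- Closed under concatenation. -/
def Mon (B : List ℕ → Prop) : Prop := B [] ∧ ∀ a b, B a → B b → B (a ++ b)

lemma gam_mon (k m : ℕ) (B : List ℕ → Prop) (hB : Mon B) : Mon (Gam k m B) := by
  refine ⟨Gam.base [] hB.1, ?_⟩
  intro a b ha hb
  induction ha with
  | base a ha =>
    cases hb with
    | base b hb => rw [← lw_append]; exact Gam.base _ (hB.2 _ _ ha hb)
    | ins b u hb hu =>
      rw [← List.append_assoc, ← lw_append]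
      exact Gam.ins _ _ (hB.2 _ _ ha hb) hu
  | ins a u ha _ ih =>
    rw [List.append_assoc, List.cons_append]
    exact Gam.ins _ _ ha ih

lemma gam_dig (k m : ℕ) (hk : 2 ≤ k) (B : List ℕ → Prop) (u : List ℕ) (hu : Gam k m B u) :
    Dig k u := by
  induction hu with
  | base a ha => exact lw_dig _ _ _ hk
  | ins a u ha _ ih =>
    intro x hx
    rcases List.mem_append.1 hx with h | h
    · exact lw_dig _ _ _ hk x h
    · rcases List.mem_cons.1 h with h | h
      · omega
      · exact ih x h

lemma suffix_replicate_append (z : ℕ) (X s : List ℕ) (h : s <:+ List.replicate z 0 ++ X) :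
    s <:+ X ∨ ∃ t, s = 0 :: t := by
  induction z with
  | zero => left; simpa using h
  | succ z ih =>
    rw [List.replicate_succ, List.cons_append] at h
    rcases List.suffix_cons_iff.1 h with h | h
    · exact Or.inr ⟨_, h⟩
    · exact ih h

lemma suffix_lw (k m : ℕ) (a r s : List ℕ) (h : s <:+ lw k m a ++ r) :
    s <:+ r ∨ (∃ a', a' <:+ a ∧ s = lw k m a' ++ r) ∨ ∃ t, s = 0 :: t := by
  induction a with
  | nil => left; simpa [lw_nil] using h
  | cons c a ih =>
    obtain ⟨z, _, hz⟩ := lamWord_eq k m c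
    rw [lw_cons, List.append_assoc] at h
    have h' := h
    rw [hz, List.cons_append] at h'
    rcases List.suffix_cons_iff.1 h' with h1 | h1
    · right; left
      refine ⟨c :: a, List.suffix_rfl, ?_⟩
      rw [lw_cons, List.append_assoc, h1, hz, List.cons_append]
    · rcases suffix_replicate_append _ _ _ h1 with h2 | h2
      · rcases ih h2 with h3 | ⟨a', h3, h4⟩ | h3
        · exact Or.inl h3
        · exact Or.inr (Or.inl ⟨a', h3.trans (List.suffix_cons _ _), h4⟩)
        · exact Or.inr (Or.inr h3)
      · exact Or.inr (Or.inr h2)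

lemma LtP_zero (k : ℕ) (hk : 2 ≤ k) (w : Seq) (hw0 : w 0 = k - 1) (t : List ℕ) :
    LtP (0 :: t) w := ⟨0, 0, t, by simp [pre_zero], by omega⟩

lemma lamSub_pos_pos (k m : ℕ) (hk : 2 ≤ k) (w : Seq) (j : ℕ) :
    0 < lamSub k m w (pos k m w j) := by
  rw [lamSub_pos_zero]
  split_ifs <;> omega

lemma LtP_lw (k m : ℕ) (hk : 2 ≤ k) (w : Seq) (hw : InSigma k w)
    (s u : List ℕ) (h : LtP s w) : LtP (lw k m s ++ u) (lamSub k m w) := by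
  obtain ⟨j, d, t, rfl, hd⟩ := h
  have hj := hw j
  rw [lw_append, lw_cons]
  by_cases h1 : d + 2 < k
  · refine ⟨pos k m w j, d + 1, lw k m t ++ u, ?_, ?_⟩
    · rw [pre_lamSub]
      simp [lamWord, h1]
    · rw [lamSub_pos_zero]
      split_ifs <;> omega
  · have h2 : d + 2 = k := by omega
    have h3 : w j = k - 1 := by omega
    refine ⟨pos k m w (j + 1), 0, lw k m t ++ u, ?_, lamSub_pos_pos k m hk w _⟩
    rw [pre_lamSub, lw_pre_succ, h3, lamWord_last k m hk]
    have : lamWord k m d = (k - 1) :: (List.replicate m 0 ++ [0]) := by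
      simp only [lamWord]
      rw [if_neg h1, if_pos h2, List.replicate_succ']
    rw [this]
    simp

lemma gam_good (k m : ℕ) (hk : 2 ≤ k) (B : List ℕ → Prop) (w : Seq)
    (hw : InSigma k w) (hw0 : w 0 = k - 1) (hG : ∀ u, B u → Good w u)
    (u : List ℕ) (hu : Gam k m B u) : Good (lamSub k m w) u := by
  have hf := lamSub_first k m w hw0
  induction hu with
  | base a ha =>
    intro s hs
    rw [← List.append_nil (lw k m a)] at hs
    rcases suffix_lw k m a [] s hs with h | ⟨a', h, rfl⟩ | ⟨t, rfl⟩
    · right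
      exact ⟨0, by rw [pre_zero]; exact List.suffix_nil.1 h⟩
    · rcases hG a ha a' h with h1 | ⟨j, rfl⟩
      · exact Or.inl (LtP_lw k m hk w hw _ _ h1)
      · right
        exact ⟨pos k m w j, by rw [pre_lamSub, List.append_nil]⟩
    · exact Or.inl (LtP_zero k hk _ hf t)
  | ins a u ha _ ih =>
    intro s hs
    rcases suffix_lw k m a (0 :: u) s hs with h | ⟨a', h, rfl⟩ | ⟨t, rfl⟩
    · rcases List.suffix_cons_iff.1 h with rfl | h
      · exact Or.inl (LtP_zero k hk _ hf u)
      · exact ih s h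
    · left
      rcases hG a ha a' h with h1 | ⟨j, rfl⟩
      · exact LtP_lw k m hk w hw _ _ h1
      · exact ⟨pos k m w j, 0, u, by rw [pre_lamSub], lamSub_pos_pos k m hk w j⟩
    · exact Or.inl (LtP_zero k hk _ hf t)

/-- Iterated closure. -/
def Bch (k : ℕ) (base : List ℕ → Prop) : (ℕ → ℕ) → ℕ → List ℕ → Prop
  | _, 0 => base
  | n, R + 1 => Gam k (n 0) (Bch k base (tl n) R)

/-- Iterated tail. -/
def tlN (n : ℕ → ℕ) (R : ℕ) : ℕ → ℕ := fun r => n (r + R)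

lemma bch_mon (k : ℕ) (base : List ℕ → Prop) (hb : Mon base) (n : ℕ → ℕ) (R : ℕ) :
    Mon (Bch k base n R) := by
  induction R generalizing n with
  | zero => exact hb
  | succ R ih => exact gam_mon _ _ _ (ih _)

lemma bch_good (k : ℕ) (hk : 2 ≤ k) (base : List ℕ → Prop) (n : ℕ → ℕ) (R : ℕ)
    (hG : ∀ u, base u → Good (Sseq k (tlN n R)) u) :
    ∀ u, Bch k base n R u → Good (Sseq k n) u := by
  induction R generalizing n with
  | zero => exact hG
  | succ R ih =>
    intro u hu
    rw [Sseq_rec k hk]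
    refine gam_good k (n 0) hk _ _ (Sseq_dig k hk _) (Sseq_first k hk _) (ih (tl n) ?_) u hu
    have : tlN (tl n) R = tlN n (R + 1) := by
      funext r
      simp only [tlN, tl]
      congr 1
    rw [this]
    exact hG

lemma bch_dig (k : ℕ) (hk : 2 ≤ k) (base : List ℕ → Prop) (hb : ∀ u, base u → Dig k u)
    (n : ℕ → ℕ) (R : ℕ) (u : List ℕ) (h : Bch k base n R u) : Dig k u := by
  cases R with
  | zero => exact hb u h
  | succ R => exact gam_dig _ _ hk _ _ h

lemma bch_base (k : ℕ) (base : List ℕ → Prop) (n : ℕ → ℕ) (R : ℕ) (u : List ℕ) (hu : base u) :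
    Bch k base n R (lwN k n R u) := by
  induction R generalizing n with
  | zero => exact hu
  | succ R ih => exact Gam.base _ (ih _)

lemma bch_zero (k : ℕ) (base : List ℕ → Prop) (hb : Mon base) (n : ℕ → ℕ) (R j : ℕ)
    (hj : j < R) : Bch k base n R (lwN k n j [0]) := by
  induction R generalizing n j with
  | zero => omega
  | succ R ih =>
    cases j with
    | zero =>
      have := Gam.ins (k := k) (m := n 0) [] _ (bch_mon k base hb (tl n) R).1
        (Gam.base [] (bch_mon k base hb (tl n) R).1)
      have h : Gam k (n 0) (Bch k base (tl n) R) [0] := by simpa [lw_nil] using this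
      exact h
    | succ j => exact Gam.base _ (ih (tl n) j (by omega))

/-! ### Block sequences -/

/-- The `i`-th block of length `L`. -/
def blk (y : Seq) (L i : ℕ) : List ℕ := (List.range L).map fun c => y (i * L + c)

lemma pre_blk (y : Seq) (L i : ℕ) : pre y ((i + 1) * L) = pre y (i * L) ++ blk y L i := by
  rw [add_mul, one_mul]
  simp only [pre, blk]
  rw [List.range_add, List.map_append, List.map_map]
  rfl

lemma pre_blk_mem (B : List ℕ → Prop) (hB : Mon B) (y : Seq) (L : ℕ)
    (h : ∀ i, B (blk y L i)) (i : ℕ) : B (pre y (i * L)) := by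
  induction i with
  | zero => rw [zero_mul, pre_zero]; exact hB.1
  | succ i ih => rw [pre_blk]; exact hB.2 _ _ ih (h i)

lemma mem_Xset (k : ℕ) (w y : Seq) (hy : InSigma k y)
    (h : ∀ N, ∃ l, N ≤ l ∧ Good w (pre y l)) : y ∈ Xset k w := by
  refine ⟨hy, fun r => ?_⟩
  have key : ∀ l, r ≤ l → ((List.range (l - r)).map fun i => y (r + i)) <:+ pre y l := by
    intro l hl
    refine ⟨pre y r, ?_⟩
    simp only [pre]
    conv_rhs => rw [show l = r + (l - r) by omega, List.range_add, List.map_append, List.map_map]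
    rfl
  by_cases hex : ∃ l, r ≤ l ∧ LtP ((List.range (l - r)).map fun i => y (r + i)) w
  · left
    obtain ⟨l, hl, j, d, t, heq, hd⟩ := hex
    have hlen := congrArg List.length heq
    simp only [List.length_map, List.length_range, List.length_append, pre_length,
      List.length_cons] at hlen
    refine ⟨j, ?_, ?_⟩
    · intro s hs
      rw [shift_iter]
      have := congrArg (fun l => l[s]?) heq
      rw [List.getElem?_append_left (by rw [pre_length]; exact hs)] at this
      rw [List.getElem?_map, List.getElem?_range (by omega), pre, List.getElem?_map,
        List.getElem?_range hs] at this
      simpa using this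
    · rw [shift_iter]
      have := congrArg (fun l => l[j]?) heq
      rw [List.getElem?_append_right (by rw [pre_length]), pre_length] at this
      rw [List.getElem?_map, List.getElem?_range (by omega)] at this
      simp at this
      rw [this]
      exact hd
  · right
    funext s
    rw [shift_iter]
    obtain ⟨l, hl, hg⟩ := h (r + s + 1)
    rcases hg _ (key l (by omega)) with h1 | ⟨j, hj⟩
    · exact absurd ⟨l, by omega, h1⟩ hex
    · have hlen := congrArg List.length hj
      simp only [List.length_map, List.length_range, pre_length] at hlen
      have := congrArg (fun l => l[s]?) hj
      rw [List.getElem?_map, List.getElem?_range (by omega), pre, List.getElem?_map,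
        List.getElem?_range (by omega)] at this
      simpa using this

/-- Frequency vectors with bounded discrepancy of block sequences. -/
def Qset (k L : ℕ) (B : List ℕ → Prop) : Set (E k) :=
  {α | α ∈ simplex k ∧ ∃ y : Seq, (∀ i, B (blk y L i)) ∧
    ∃ C : ℝ, ∀ (i : ℕ) (d : Fin k),
      |((pre y (i * L)).count (d : ℕ) : ℝ) - (i * L : ℕ) * α d| ≤ C}

lemma Qset_subset (k L : ℕ) (hL : 0 < L) (B : List ℕ → Prop) (hB : Mon B)
    (hd : ∀ u, B u → Dig k u) (w : Seq) (hG : ∀ u, B u → Good w u) :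
    Qset k L B ⊆ DFw k w := by
  rintro α ⟨hα, y, hy, C, hC⟩
  have hyk : InSigma k y := by
    intro p
    have := hd _ (hy (p / L))
    apply this
    simp only [blk, List.mem_map, List.mem_range]
    refine ⟨p % L, Nat.mod_lt _ hL, ?_⟩
    rw [mul_comm, Nat.div_add_mod]
  refine ⟨hα, y, ?_, ?_⟩
  · apply mem_Xset k w y hyk
    intro N
    exact ⟨N * L, Nat.le_mul_of_pos_right _ hL, hG _ (pre_blk_mem B hB y L hy N)⟩
  · intro d hdk
    have hpr : proj α d = α ⟨d, hdk⟩ := by simp [proj, hdk]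
    rw [hpr]
    set x := α ⟨d, hdk⟩ with hx
    have hb : ∀ r : ℕ, |(digitCount y d r : ℝ) - r * x| ≤ C + L + L * |x| := by
      intro r
      have h1 := hC (r / L) ⟨d, hdk⟩
      simp only at h1
      rw [← hx, ← digitCount_eq] at h1
      set q := r / L * L with hq
      have hqr : q + r % L = r := by rw [hq, mul_comm, Nat.div_add_mod]
      have hlt := Nat.mod_lt r hL
      have h2 : digitCount y d q ≤ digitCount y d r := by
        unfold digitCount
        gcongr
        omega
      have h3 : digitCount y d r ≤ digitCount y d q + L := by
        rw [← hqr]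
        generalize r % L = c at hlt
        have : ∀ c, digitCount y d (q + c) ≤ digitCount y d q + c := by
          intro c
          induction c with
          | zero => simp
          | succ c ih =>
            rw [← add_assoc, digitCount_eq, pre_succ, List.count_append, ← digitCount_eq]
            have : List.count d [y (q + c)] ≤ 1 := List.count_le_length
            omega
        have := this c
        omega
      have h2' : (digitCount y d q : ℝ) ≤ digitCount y d r := by exact_mod_cast h2
      have h3' : (digitCount y d r : ℝ) ≤ digitCount y d q + L := by exact_mod_cast h3
      have h4 : (r : ℝ) = q + (r % L : ℕ) := by exact_mod_cast hqr.symm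
      have h5 : ((r % L : ℕ) : ℝ) ≤ L := by exact_mod_cast hlt.le
      have e : (digitCount y d r : ℝ) - r * x = ((digitCount y d q : ℝ) - q * x) +
        ((digitCount y d r : ℝ) - digitCount y d q) - (r % L : ℕ) * x := by rw [h4]; ring
      rw [e]
      have h6 : |((r % L : ℕ) : ℝ) * x| ≤ L * |x| := by
        rw [abs_mul, abs_of_nonneg (Nat.cast_nonneg _)]
        gcongr
      have h7 : |(digitCount y d r : ℝ) - digitCount y d q| ≤ L := by
        rw [abs_le]; constructor <;> linarith [(Nat.cast_nonneg L : (0 : ℝ) ≤ L)]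
      calc _ ≤ |((digitCount y d q : ℝ) - q * x) + ((digitCount y d r : ℝ) - digitCount y d q)| +
            |((r % L : ℕ) : ℝ) * x| := abs_sub _ _
        _ ≤ (|((digitCount y d q : ℝ) - q * x)| + |((digitCount y d r : ℝ) - digitCount y d q)|) +
            |((r % L : ℕ) : ℝ) * x| := by gcongr; exact abs_add_le _ _
        _ ≤ _ := by linarith
    rw [tendsto_iff_norm_sub_tendsto_zero]
    refine squeeze_zero' (Eventually.of_forall fun _ => norm_nonneg _) ?_
      (tendsto_const_div_atTop_nhds_zero_nat (C + L + L * |x|))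
    filter_upwards [eventually_gt_atTop 0] with r hr
    have hr' : (0 : ℝ) < r := by exact_mod_cast hr
    have e : (digitCount y d r : ℝ) / r - x = ((digitCount y d r : ℝ) - r * x) / r := by
      field_simp
    rw [e, Real.norm_eq_abs, abs_div, abs_of_pos hr']
    gcongr
    exact hb r

lemma simplex_convex (k : ℕ) : Convex ℝ (simplex k) := by
  intro x hx y hy a b ha hb hab
  refine ⟨fun i => ?_, ?_⟩
  · have := hx.1 i
    have := hy.1 i
    simp only [PiLp.add_apply, PiLp.smul_apply, smul_eq_mul]
    positivity
  · simp only [PiLp.add_apply, PiLp.smul_apply, smul_eq_mul, Finset.sum_add_distrib,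
      ← Finset.mul_sum]
    rw [hx.2, hy.2]
    linarith

lemma Qset_convex (k L : ℕ) (B : List ℕ → Prop) : Convex ℝ (Qset k L B) := by
  rcases Nat.eq_zero_or_pos L with hL0 | hL
  · subst hL0
    have : Qset k 0 B = {α | α ∈ simplex k ∧ ∃ y : Seq, ∀ i, B (blk y 0 i)} := by
      ext α
      simp only [Qset, Set.mem_ofPred_eq]
      constructor
      · rintro ⟨h, y, h1, _⟩
        exact ⟨h, y, h1⟩
      · rintro ⟨h, y, h1⟩
        exact ⟨h, y, h1, 0, by simp [pre_zero]⟩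
    rw [this]
    intro x hx y hy a b ha hb hab
    exact ⟨simplex_convex k hx.1 hy.1 ha hb hab, hx.2⟩
  intro x hx y hy t t' ht ht' htt
  have hsx := simplex_convex k hx.1 hy.1 ht ht' htt
  obtain ⟨hx1, u, hu, C, hC⟩ := hx
  obtain ⟨hy1, v, hv, D, hD⟩ := hy
  refine ⟨hsx, ?_⟩
  let a : ℕ → ℕ := fun i => ⌊(i : ℝ) * t⌋₊
  have ha0 : a 0 = 0 := by simp [a]
  have ha1 : ∀ i : ℕ, (a i : ℝ) ≤ i * t := fun i => Nat.floor_le (by positivity)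
  have ha2 : ∀ i : ℕ, (i : ℝ) * t < a i + 1 := fun i => Nat.lt_floor_add_one _
  have hai : ∀ i, a i ≤ i := by
    intro i
    have h1 := ha1 i
    have h2 : (i : ℝ) * t ≤ i * 1 := by gcongr; linarith
    have : (a i : ℝ) ≤ i := by linarith
    exact_mod_cast this
  have hmono : ∀ i, a i ≤ a (i + 1) := by
    intro i
    apply Nat.floor_mono
    push_cast
    nlinarith
  have hstep : ∀ i, a (i + 1) = a i + 1 ∨ a (i + 1) = a i := by
    intro i
    have h1 := ha1 (i + 1)
    have h2 := ha2 i
    push_cast at h1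
    have h3 : (a (i + 1) : ℝ) < a i + 2 := by nlinarith
    have h4 : a (i + 1) < a i + 2 := by exact_mod_cast h3
    have := hmono i
    omega
  let z : Seq := fun p => if a (p / L + 1) = a (p / L) + 1 then u (a (p / L) * L + p % L)
    else v ((p / L - a (p / L)) * L + p % L)
  have hz : ∀ i, blk z L i = if a (i + 1) = a i + 1 then blk u L (a i) else blk v L (i - a i) := by
    intro i
    have h1 : ∀ c ∈ List.range L, z (i * L + c) =
        if a (i + 1) = a i + 1 then u (a i * L + c) else v ((i - a i) * L + c) := by
      intro c hc
      have hc := List.mem_range.1 hc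
      have e1 : (i * L + c) / L = i := by
        rw [mul_comm, Nat.mul_add_div hL, Nat.div_eq_of_lt hc, add_zero]
      have e2 : (i * L + c) % L = c := by
        rw [mul_comm, Nat.mul_add_mod, Nat.mod_eq_of_lt hc]
      simp only [z, e1, e2]
    simp only [blk]
    rw [List.map_congr_left h1]
    split_ifs <;> rfl
  have hcount : ∀ i d, (pre z (i * L)).count d =
      (pre u (a i * L)).count d + (pre v ((i - a i) * L)).count d := by
    intro i d
    induction i with
    | zero => simp [pre_zero, ha0]
    | succ i ih =>
      rw [pre_blk, List.count_append, ih, hz]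
      have := hai i
      rcases hstep i with h | h
      · rw [if_pos h, h, pre_blk, List.count_append]
        have : i + 1 - (a i + 1) = i - a i := by omega
        rw [this]
        ring
      · rw [if_neg (by omega), h]
        have : i + 1 - a i = (i - a i) + 1 := by omega
        rw [this, pre_blk, List.count_append]
        ring
  refine ⟨z, ?_, C + D + L * (∑ d, |x d|) + L * (∑ d, |y d|), ?_⟩
  · intro i
    rw [hz]
    split_ifs
    · exact hu _
    · exact hv _
  · intro i d
    have h1 := hC (a i) d
    have h2 := hD (i - a i) d
    rw [hcount]
    have h3 : ((i - a i : ℕ) : ℝ) = i - a i := by rw [Nat.cast_sub (hai i)]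
    have hsx' : |x d| ≤ ∑ d, |x d| :=
      Finset.single_le_sum (f := fun d => |x d|) (fun _ _ => abs_nonneg _) (Finset.mem_univ d)
    have hsy' : |y d| ≤ ∑ d, |y d| :=
      Finset.single_le_sum (f := fun d => |y d|) (fun _ _ => abs_nonneg _) (Finset.mem_univ d)
    have hθ : |(a i : ℝ) - i * t| ≤ 1 := by
      rw [abs_le]; constructor <;> linarith [ha1 i, ha2 i]
    simp only [PiLp.add_apply, PiLp.smul_apply, smul_eq_mul]
    push_cast at h1 h2 ⊢
    rw [h3] at h2
    have ht2 : t' = 1 - t := by linarith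
    rw [ht2]
    set cu : ℝ := ((pre u (a i * L)).count (d : ℕ) : ℝ)
    set cv : ℝ := ((pre v ((i - a i) * L)).count (d : ℕ) : ℝ)
    have e : cu + cv - i * L * (t * x d + (1 - t) * y d) =
        (cu - a i * L * x d) + (cv - (i - a i) * L * y d) +
        ((a i : ℝ) - i * t) * (L * x d) - ((a i : ℝ) - i * t) * (L * y d) := by ring
    rw [e]
    have hL' : (0 : ℝ) ≤ L := Nat.cast_nonneg L
    have h4 : |((a i : ℝ) - i * t) * (L * x d)| ≤ L * ∑ d, |x d| := by
      rw [abs_mul, abs_mul, abs_of_nonneg hL']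
      calc _ ≤ 1 * (L * |x d|) := by gcongr
        _ ≤ _ := by rw [one_mul]; gcongr
    have h5 : |((a i : ℝ) - i * t) * (L * y d)| ≤ L * ∑ d, |y d| := by
      rw [abs_mul, abs_mul, abs_of_nonneg hL']
      calc _ ≤ 1 * (L * |y d|) := by gcongr
        _ ≤ _ := by rw [one_mul]; gcongr
    rw [abs_le] at h1 h2 h4 h5 ⊢
    constructor <;> linarith [h1.1, h1.2, h2.1, h2.2, h4.1, h4.2, h5.1, h5.2]

/-- Frequency vector of a word. -/
noncomputable def ptw (k : ℕ) (l : List ℕ) : E k :=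
  WithLp.toLp 2 fun i : Fin k => (l.count (i : ℕ) : ℝ) / l.length

lemma ptw_apply (k : ℕ) (l : List ℕ) (i : Fin k) :
    ptw k l i = (l.count (i : ℕ) : ℝ) / l.length := rfl

lemma wt_ptw (k : ℕ) (f : ℕ → ℝ) (l : List ℕ) (hl : Dig k l) :
    ∑ i : Fin k, f i * ptw k l i = wt f l / l.length := by
  rw [wt_eq_sum k f l hl, Finset.sum_div]
  refine Finset.sum_congr rfl fun i _ => ?_
  rw [ptw_apply, mul_div_assoc]

lemma wt_one (l : List ℕ) : wt (fun _ => 1) l = l.length := by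
  induction l with
  | nil => simp [wt_nil]
  | cons a l ih => rw [wt_cons, ih]; push_cast [List.length_cons]; ring

lemma ptw_simplex (k : ℕ) (l : List ℕ) (hl : Dig k l) (hne : l ≠ []) : ptw k l ∈ simplex k := by
  constructor
  · intro i
    rw [ptw_apply]
    positivity
  · have := wt_ptw k (fun _ => 1) l hl
    simp only [one_mul] at this
    rw [this, wt_one]
    have : (l.length : ℝ) ≠ 0 := by
      have := List.length_pos_iff.2 hne
      positivity
    field_simp

lemma ptw_mem_Q (k : ℕ) (B : List ℕ → Prop) (hB : Mon B) (g : List ℕ) (hg : B g)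
    (hd : Dig k g) (hne : g ≠ []) (L : ℕ) (hL : g.length ∣ L) : ptw k g ∈ Qset k L B := by
  refine ⟨ptw_simplex k g hd hne, fun p => g.getD (p % g.length) 0, ?_⟩
  have hpos := List.length_pos_iff.2 hne
  obtain ⟨c, rfl⟩ := hL
  set y : Seq := fun p => g.getD (p % g.length) 0 with hy
  have h1 : ∀ i, blk y g.length i = g := by
    intro i
    apply List.ext_getElem
    · simp [blk]
    · intro q h1 h2
      simp only [blk, List.getElem_map, List.getElem_range, hy]
      rw [mul_comm, Nat.mul_add_mod, Nat.mod_eq_of_lt h2, List.getD_eq_getElem _ _ h2]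
  have h2 : ∀ i c, ((List.range (c * g.length)).map fun q => y (i * g.length + q)) =
      (List.replicate c g).flatten := by
    intro i c
    induction c with
    | zero => simp
    | succ c ih =>
      rw [add_mul, one_mul, List.range_add, List.map_append, ih, List.replicate_succ',
        List.flatten_append, List.map_map]
      congr 1
      have := h1 (i + c)
      simp only [blk] at this
      simp only [List.flatten_cons, List.flatten_nil, List.append_nil]
      conv_rhs => rw [← this]
      apply List.map_congr_left
      intro a _
      simp only [Function.comp]
      congr 1
      ring
  have h3 : ∀ c, B (List.replicate c g).flatten := by
    intro c
    induction c with
    | zero => exact hB.1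
    | succ c ih =>
      rw [List.replicate_succ, List.flatten_cons]
      exact hB.2 _ _ hg ih
  refine ⟨?_, 0, ?_⟩
  · intro i
    have := h2 (i * c) c
    have e : blk y (g.length * c) i = (List.replicate c g).flatten := by
      rw [← this]
      simp only [blk]
      rw [mul_comm g.length c]
      apply List.map_congr_left
      intro a _
      congr 1
      ring
    rw [e]
    exact h3 c
  · intro i d
    have := h2 0 (i * c)
    have e : pre y (i * (g.length * c)) = (List.replicate (i * c) g).flatten := by
      rw [← this]
      simp only [pre, zero_mul, zero_add]
      congr 2
      ring
    rw [e, ptw_apply]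
    have hc : ((List.replicate (i * c) g).flatten).count (d : ℕ) = (i * c) * g.count (d : ℕ) := by
      rw [List.count_flatten]
      simp
    rw [hc]
    have : (g.length : ℝ) ≠ 0 := by positivity
    push_cast
    rw [show (i : ℝ) * c * (g.count (d : ℕ)) - i * (g.length * c) * ((g.count (d : ℕ)) / g.length) = 0
      by field_simp; ring]
    simp

/-! ### Case `k = 2` -/

lemma two_aux (A : Set (E 2)) (hA : A ⊆ simplex 2) (p q r : E 2)
    (hp : p ∈ A) (hr : r ∈ A) (hq : q ∈ Set.extremePoints ℝ A)
    (h1 : p 0 < q 0) (h2 : q 0 < r 0) : False := by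
  have sp := (hA hp).2
  have sq := (hA hq.1).2
  have sr := (hA hr).2
  rw [Fin.sum_univ_two] at sp sq sr
  have h := (mem_extremePoints_iff_left.1 hq).2 p hp r hr
  have hseg : q ∈ openSegment ℝ p r := by
    have hd : 0 < r 0 - p 0 := by linarith
    refine ⟨(r 0 - q 0) / (r 0 - p 0), (q 0 - p 0) / (r 0 - p 0),
      div_pos (by linarith) hd, div_pos (by linarith) hd, ?_, ?_⟩
    · field_simp
      ring
    · have e0 : (r 0 - q 0) / (r 0 - p 0) * p 0 + (q 0 - p 0) / (r 0 - p 0) * r 0 = q 0 := by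
        field_simp
        ring
      have e1 : (r 0 - q 0) / (r 0 - p 0) * p 1 + (q 0 - p 0) / (r 0 - p 0) * r 1 = q 1 := by
        rw [show p 1 = 1 - p 0 by linarith, show r 1 = 1 - r 0 by linarith,
          show q 1 = 1 - q 0 by linarith]
        field_simp
        ring
      ext i
      fin_cases i
      · simpa using e0
      · simpa using e1
  have := h hseg
  rw [this] at h1
  exact lt_irrefl _ h1

lemma two_finite (A : Set (E 2)) (hA : A ⊆ simplex 2) : (Set.extremePoints ℝ A).Finite := by
  by_contra hinf
  have hinf : (Set.extremePoints ℝ A).Infinite := hinf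
  obtain ⟨t, ht, hc⟩ := hinf.exists_subset_card_eq 3
  obtain ⟨a, b, c, hab, hac, hbc, rfl⟩ := Finset.card_eq_three.1 hc
  have ha : a ∈ Set.extremePoints ℝ A := ht (by simp)
  have hb : b ∈ Set.extremePoints ℝ A := ht (by simp)
  have hcc : c ∈ Set.extremePoints ℝ A := ht (by simp)
  have inj : ∀ x y : E 2, x ∈ A → y ∈ A → x 0 = y 0 → x = y := by
    intro x y hx hy h
    have sx := (hA hx).2
    have sy := (hA hy).2
    rw [Fin.sum_univ_two] at sx sy
    ext i
    fin_cases i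
    · exact h
    · show x 1 = y 1
      linarith
  have key := two_aux A hA
  rcases lt_trichotomy (a 0) (b 0) with h1 | h1 | h1
  · rcases lt_trichotomy (b 0) (c 0) with h2 | h2 | h2
    · exact key a b c ha.1 hcc.1 hb h1 h2
    · exact hbc (inj _ _ hb.1 hcc.1 h2)
    · rcases lt_trichotomy (a 0) (c 0) with h3 | h3 | h3
      · exact key a c b ha.1 hb.1 hcc h3 h2
      · exact hac (inj _ _ ha.1 hcc.1 h3)
      · exact key c a b hcc.1 hb.1 ha h3 h1
  · exact hab (inj _ _ ha.1 hb.1 h1)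
  · rcases lt_trichotomy (b 0) (c 0) with h2 | h2 | h2
    · rcases lt_trichotomy (a 0) (c 0) with h3 | h3 | h3
      · exact key b a c hb.1 hcc.1 ha h1 h3
      · exact hac (inj _ _ ha.1 hcc.1 h3)
      · exact key b c a hb.1 ha.1 hcc h2 h3
    · exact hbc (inj _ _ hb.1 hcc.1 h2)
    · exact key c b a hcc.1 ha.1 hb h2 h1

/-! ### Rational type -/

lemma dig_good_top (k : ℕ) (u : List ℕ) (hu : Dig k u) :
    LtP u (topSeq k) ∨ ∃ j, u = pre (topSeq k) j := by
  have e : ∀ j, pre (topSeq k) j = List.replicate j (k - 1) := by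
    intro j
    induction j with
    | zero => rfl
    | succ j ih =>
      rw [pre_succ, ih, List.replicate_succ']
      rfl
  induction u with
  | nil => exact Or.inr ⟨0, rfl⟩
  | cons a u ih =>
    have ha := hu a (by simp)
    by_cases h : a = k - 1
    · rcases ih (fun x hx => hu x (List.mem_cons_of_mem _ hx)) with ⟨j, d, t, h1, h2⟩ | ⟨j, h1⟩
      · left
        refine ⟨j + 1, d, t, ?_, h2⟩
        rw [h1, e, e, List.replicate_succ, h, List.cons_append]
      · right
        refine ⟨j + 1, ?_⟩
        rw [h1, e, e, List.replicate_succ, h]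
    · left
      refine ⟨0, a, u, by simp [pre_zero], ?_⟩
      simp only [topSeq]
      omega

lemma dig_mon (k : ℕ) : Mon (Dig k) := by
  refine ⟨by intro a ha; simp at ha, ?_⟩
  intro a b ha hb x hx
  rcases List.mem_append.1 hx with h | h
  · exact ha x h
  · exact hb x h

lemma rational_finite (k : ℕ) (hk : 2 ≤ k) (n : ℕ → ℕ) (R : ℕ) (hR : ∀ r, R ≤ r → n r = 0) :
    (Set.extremePoints ℝ (DFn k n)).Finite := by
  let G : Finset (List ℕ) := (Finset.range (R + 1)).image (fun j => lwN k n j [0]) ∪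
    (Finset.range k).image (fun i => lwN k n (R + 1) [i])
  have hGd : ∀ g ∈ G, Dig k g ∧ g ≠ [] ∧ Bch k (Dig k) n (R + 1) g := by
    intro g hg
    simp only [G, Finset.mem_union, Finset.mem_image, Finset.mem_range] at hg
    rcases hg with ⟨j, hj, rfl⟩ | ⟨i, hi, rfl⟩
    · refine ⟨lwN_dig k hk n j _ ?_, lwN_ne_nil k n j _ (by simp),
        bch_zero k _ (dig_mon k) n _ j hj⟩
      intro a ha
      simp at ha
      omega
    · have hd : Dig k [i] := by
        intro a ha
        simp at ha
        omega
      exact ⟨lwN_dig k hk n _ _ hd, lwN_ne_nil k n _ _ (by simp), bch_base k _ n _ _ hd⟩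
  let L : ℕ := ∏ g ∈ G, g.length
  have hL : 0 < L := Finset.prod_pos fun g hg => List.length_pos_iff.2 (hGd g hg).2.1
  let P : Set (E k) := (ptw k) '' (G : Set (List ℕ))
  have hPf : P.Finite := (Finset.finite_toSet G).image _
  have hS : Sseq k (tlN n (R + 1)) = topSeq k := by
    apply Sseq_zero k hk
    intro r
    exact hR _ (by omega)
  have hmon := bch_mon k (Dig k) (dig_mon k) n (R + 1)
  have hsub : convexHull ℝ P ⊆ DFn k n := by
    have h1 : convexHull ℝ P ⊆ Qset k L (Bch k (Dig k) n (R + 1)) := by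
      apply convexHull_min _ (Qset_convex _ _ _)
      rintro _ ⟨g, hg, rfl⟩
      have hg : g ∈ G := hg
      obtain ⟨h1, h2, h3⟩ := hGd g hg
      exact ptw_mem_Q k _ hmon g h3 h1 h2 L (Finset.dvd_prod_of_mem (fun g => g.length) hg)
    refine h1.trans (Qset_subset k L hL _ hmon ?_ _ ?_)
    · exact bch_dig k hk _ (fun u hu => hu) n _
    · apply bch_good k hk
      intro u hu s hs
      rw [hS]
      exact dig_good_top k s fun a ha => hu a (hs.subset ha)
  have hsup : DFn k n ⊆ convexHull ℝ P := by
    intro α hα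
    by_contra hn
    obtain ⟨f, u, hf1, hf2⟩ := geometric_hahn_banach_point_closed (convex_convexHull ℝ P)
      (hPf.isCompact_convexHull ℝ).isClosed hn
    let g : ℕ → ℝ := fun i => f (evec k i) - u
    have hfx : ∀ x : E k, x ∈ simplex k → ∑ i : Fin k, g i * x i = f x - u := by
      intro x hx
      have hx' : x = ∑ i : Fin k, x i • evec k i := by
        ext j
        simp [evec, Fin.val_inj]
      have : f x = ∑ i : Fin k, x i * f (evec k i) := by
        conv_lhs => rw [hx']
        simp
      rw [this]
      simp only [g, sub_mul]
      rw [Finset.sum_sub_distrib, ← Finset.mul_sum, hx.2, mul_one]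
      congr 1
      exact Finset.sum_congr rfl fun i _ => mul_comm _ _
    have hw : ∀ w ∈ G, 0 ≤ wt g w := by
      intro w hw
      obtain ⟨h1, h2, _⟩ := hGd w hw
      have h3 := hfx _ (ptw_simplex k w h1 h2)
      rw [wt_ptw k g w h1] at h3
      have h4 := hf2 (ptw k w) (subset_convexHull ℝ P ⟨w, hw, rfl⟩)
      have h5 : (0 : ℝ) < w.length := by exact_mod_cast List.length_pos_iff.2 h2
      have h6 : 0 < wt g w / w.length := by linarith
      exact ((div_pos_iff_of_pos_right h5).1 h6).le
    have := upper k hk R n g (fun j hj => hw _ (Finset.mem_union_left _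
        (Finset.mem_image.2 ⟨j, Finset.mem_range.2 hj, rfl⟩)))
      (fun i hi => hw _ (Finset.mem_union_right _
        (Finset.mem_image.2 ⟨i, Finset.mem_range.2 hi, rfl⟩))) α hα
    rw [hfx α hα.1] at this
    linarith
  rw [Set.Subset.antisymm hsup hsub]
  exact hPf.subset extremePoints_convexHull_subset

/-! ### Not of rational type -/

/-- Push a weight forward. -/
noncomputable def push (k m : ℕ) (g : ℕ → ℝ) : ℕ → ℝ := fun i =>
  if i = 0 then g (k - 2) - g (k - 1)
  else if i + 1 < k then g (i - 1)
  else g (k - 1) - m * (g (k - 2) - g (k - 1))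

lemma pull_push (k m : ℕ) (hk : 3 ≤ k) (g : ℕ → ℝ) (i : ℕ) (hi : i < k) :
    pull k m (push k m g) i = g i := by
  have h0 : push k m g 0 = g (k - 2) - g (k - 1) := by simp [push]
  have hl : push k m g (k - 1) = g (k - 1) - m * (g (k - 2) - g (k - 1)) := by
    simp only [push]
    rw [if_neg (by omega), if_neg (by omega)]
  simp only [pull, lamWord]
  split_ifs with h1 h2
  · rw [wt_singleton]
    simp only [push]
    rw [if_neg (by omega), if_pos (by omega)]
    simp
  · rw [wt_cons, wt_replicate, h0, hl]
    have : i = k - 2 := by omega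
    rw [this]
    push_cast
    ring
  · rw [wt_cons, wt_replicate, h0, hl]
    have : i = k - 1 := by omega
    rw [this]
    ring

lemma wt_push_lw (k m : ℕ) (hk : 3 ≤ k) (g : ℕ → ℝ) (l : List ℕ) (hl : Dig k l) :
    wt (push k m g) (lw k m l) = wt g l := by
  rw [wt_lw]
  exact wt_congr k _ _ l hl (pull_push k m hk g)

lemma sing_dig (k i : ℕ) (hi : i < k) : Dig k [i] := by
  intro a ha
  simp at ha
  omega

lemma exists_F (k : ℕ) (hk : 3 ≤ k) (r : ℕ) (n : ℕ → ℕ) (hr : n r ≠ 0) :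
    ∃ F : ℕ → ℝ, 0 < F 0 ∧ (∀ i, i + 2 ≤ k → 0 ≤ F i) ∧ F (k - 1) < 0 ∧
      (∀ j, j < r + 1 → 0 < wt F (lwN k n j [0])) ∧
      wt F (lwN k n (r + 1) [0]) = 0 ∧
      ∀ i, 1 ≤ i → i < k → 0 < wt F (lwN k n (r + 1) [i]) := by
  induction r generalizing n with
  | zero =>
    let g : ℕ → ℝ := fun i => if i = 0 then 0 else if i = k - 2 then 3 else 1
    have g0 : g 0 = 0 := by simp [g]
    have gk : g (k - 2) = 3 := by
      simp only [g]
      rw [if_neg (by omega)]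
      simp
    have gl : g (k - 1) = 1 := by
      simp only [g]
      rw [if_neg (by omega), if_neg (by omega)]
    have gnn : ∀ i, 0 ≤ g i := by
      intro i
      simp only [g]
      split_ifs <;> norm_num
    have gpos : ∀ i, 1 ≤ i → 0 < g i := by
      intro i hi
      simp only [g]
      rw [if_neg (by omega)]
      split_ifs <;> norm_num
    have f0 : push k (n 0) g 0 = 2 := by
      simp only [push]
      rw [if_pos trivial, gk, gl]
      norm_num
    have hw : ∀ i, i < k → wt (push k (n 0) g) (lwN k n (0 + 1) [i]) = g i := by
      intro i hi
      show wt (push k (n 0) g) (lw k (n 0) [i]) = g i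
      rw [wt_push_lw k _ hk g _ (sing_dig k i hi), wt_singleton]
    refine ⟨push k (n 0) g, by rw [f0]; norm_num, ?_, ?_, ?_, ?_, ?_⟩
    · intro i hi
      rcases Nat.eq_zero_or_pos i with h | h
      · rw [h, f0]; norm_num
      · simp only [push]
        rw [if_neg (by omega), if_pos (by omega)]
        exact gnn _
    · simp only [push]
      rw [if_neg (by omega), if_neg (by omega), gk, gl]
      have : (1 : ℝ) ≤ n 0 := by exact_mod_cast Nat.one_le_iff_ne_zero.2 hr
      linarith
    · intro j hj
      have : j = 0 := by omega
      subst this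
      show 0 < wt _ [0]
      rw [wt_singleton, f0]
      norm_num
    · rw [hw 0 (by omega), g0]
    · intro i h1 h2
      rw [hw i h2]
      exact gpos i h1
  | succ r ih =>
    obtain ⟨g, h1, h2, h3, h4, h5, h6⟩ := ih (tl n) hr
    have hgk := h2 (k - 2) (by omega)
    have f0 : 0 < push k (n 0) g 0 := by
      simp only [push]
      rw [if_pos trivial]
      linarith
    have hw : ∀ i j, i < k → wt (push k (n 0) g) (lwN k n (j + 1) [i]) =
        wt g (lwN k (tl n) j [i]) := by
      intro i j hi
      show wt (push k (n 0) g) (lw k (n 0) _) = _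
      rw [wt_push_lw k _ hk g _ (lwN_dig k (by omega) _ _ _ (sing_dig k i hi))]
    refine ⟨push k (n 0) g, f0, ?_, ?_, ?_, ?_, ?_⟩
    · intro i hi
      rcases Nat.eq_zero_or_pos i with h | h
      · rw [h]; exact f0.le
      · simp only [push]
        rw [if_neg (by omega), if_pos (by omega)]
        exact h2 _ (by omega)
    · simp only [push]
      rw [if_neg (by omega), if_neg (by omega)]
      have : (0 : ℝ) ≤ n 0 * (g (k - 2) - g (k - 1)) :=
        mul_nonneg (Nat.cast_nonneg _) (by linarith)
      linarith
    · intro j hj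
      cases j with
      | zero =>
        show 0 < wt _ [0]
        rw [wt_singleton]
        exact f0
      | succ j =>
        rw [hw _ _ (by omega)]
        exact h4 j (by omega)
    · rw [hw _ _ (by omega)]
      exact h5
    · intro i hi1 hi2
      rw [hw _ _ hi2]
      exact h6 i hi1 hi2

lemma wt_lin (f g : ℕ → ℝ) (K : ℝ) (l : List ℕ) :
    wt (fun i => g i + K * f i) l = wt g l + K * wt f l := by
  induction l with
  | nil => simp [wt_nil]
  | cons a l ih => rw [wt_cons, wt_cons, wt_cons, ih]; ring

lemma wt_neg (g : ℕ → ℝ) (l : List ℕ) : wt (fun i => - g i) l = - wt g l := by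
  induction l with
  | nil => simp [wt_nil]
  | cons a l ih => rw [wt_cons, wt_cons, ih]; ring

lemma exists_K (S : Finset (ℝ × ℝ)) (hS : ∀ p ∈ S, 0 < p.2) :
    ∃ K : ℝ, ∀ p ∈ S, 0 ≤ p.1 + K * p.2 := by
  refine ⟨∑ p ∈ S, |p.1| / p.2, fun p hp => ?_⟩
  have h1 : |p.1| / p.2 ≤ ∑ p ∈ S, |p.1| / p.2 :=
    Finset.single_le_sum (f := fun p : ℝ × ℝ => |p.1| / p.2)
      (fun q hq => div_nonneg (abs_nonneg _) (hS q hq).le) hp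
  have h2 := hS p hp
  have h3 : |p.1| ≤ (∑ p ∈ S, |p.1| / p.2) * p.2 := by
    rwa [div_le_iff₀ h2] at h1
  linarith [neg_abs_le p.1]

lemma pt_mem (k : ℕ) (hk : 2 ≤ k) (n : ℕ → ℕ) (R : ℕ) : ptw k (lwN k n R [0]) ∈ DFn k n := by
  let base : List ℕ → Prop := fun u => ∀ a ∈ u, a = 0
  have hb : Mon base := by
    refine ⟨by intro a ha; simp at ha, ?_⟩
    intro a b ha hb x hx
    rcases List.mem_append.1 hx with h | h
    · exact ha x h
    · exact hb x h
  have hd : ∀ u, base u → Dig k u := fun u hu a ha => by rw [hu a ha]; omega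
  have hmon := bch_mon k base hb n R
  have hne := lwN_ne_nil k n R [0] (by simp)
  refine Qset_subset k _ (List.length_pos_iff.2 hne) _ hmon (bch_dig k hk base hd n R) _ ?_
    (ptw_mem_Q k _ hmon (lwN k n R [0]) (bch_base k base n R _ ?_)
      (lwN_dig k hk n R _ (sing_dig k 0 (by omega))) hne _ (dvd_refl _))
  · apply bch_good k hk
    intro u hu s hs
    cases s with
    | nil => exact Or.inr ⟨0, rfl⟩
    | cons a s =>
      have : a = 0 := hu a (hs.subset (by simp))
      rw [this]
      exact Or.inl (LtP_zero k hk _ (Sseq_first k hk _) s)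
  · intro a ha
    simpa using ha

lemma pt_extreme (k : ℕ) (hk : 3 ≤ k) (n : ℕ → ℕ) (r : ℕ) (hr : n r ≠ 0) :
    ptw k (lwN k n (r + 1) [0]) ∈ Set.extremePoints ℝ (DFn k n) := by
  have hk2 : 2 ≤ k := by omega
  obtain ⟨F, -, -, -, h4, h5, h6⟩ := exists_F k hk r n hr
  set W := lwN k n (r + 1) [0] with hW
  have hWd : Dig k W := lwN_dig k hk2 n _ _ (sing_dig k 0 (by omega))
  have hWne : W ≠ [] := lwN_ne_nil k n _ _ (by simp)
  have hlen : (0 : ℝ) < W.length := by exact_mod_cast List.length_pos_iff.2 hWne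
  have hF : ∀ x ∈ DFn k n, 0 ≤ ∑ i : Fin k, F i * x i := by
    intro x hx
    refine upper k hk2 r n F (fun j hj => (h4 j hj).le) ?_ x hx
    intro i hi
    rcases Nat.eq_zero_or_pos i with h | h
    · rw [h, ← hW, h5]
    · exact (h6 i h hi).le
  have hg : ∀ x ∈ DFn k n, ∑ i : Fin k, F i * x i = 0 → ∀ g : ℕ → ℝ, wt g W = 0 →
      0 ≤ ∑ i : Fin k, g i * x i := by
    intro x hx hx0 g hgW
    let S : Finset (ℝ × ℝ) := (Finset.range (r + 1)).image
        (fun j => (wt g (lwN k n j [0]), wt F (lwN k n j [0]))) ∪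
      (Finset.Ico 1 k).image (fun i => (wt g (lwN k n (r + 1) [i]), wt F (lwN k n (r + 1) [i])))
    obtain ⟨K, hK⟩ := exists_K S (by
      intro p hp
      simp only [S, Finset.mem_union, Finset.mem_image, Finset.mem_range, Finset.mem_Ico] at hp
      rcases hp with ⟨j, hj, rfl⟩ | ⟨i, hi, rfl⟩
      · exact h4 j hj
      · exact h6 i hi.1 hi.2)
    have := upper k hk2 r n (fun i => g i + K * F i) ?_ ?_ x hx
    · have e : ∑ i : Fin k, (g i + K * F i) * x i =
          ∑ i : Fin k, g i * x i + K * ∑ i : Fin k, F i * x i := by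
        rw [Finset.mul_sum, ← Finset.sum_add_distrib]
        exact Finset.sum_congr rfl fun i _ => by ring
      rw [e, hx0] at this
      linarith
    · intro j hj
      rw [wt_lin]
      exact hK _ (Finset.mem_union_left _ (Finset.mem_image.2 ⟨j, Finset.mem_range.2 hj, rfl⟩))
    · intro i hi
      rw [wt_lin]
      rcases Nat.eq_zero_or_pos i with h | h
      · rw [h, ← hW, h5, hgW]
        simp
      · exact hK _ (Finset.mem_union_right _
          (Finset.mem_image.2 ⟨i, Finset.mem_Ico.2 ⟨h, hi⟩, rfl⟩))
  have huniq : ∀ x ∈ DFn k n, ∑ i : Fin k, F i * x i = 0 → x = ptw k W := by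
    intro x hx hx0
    ext d
    let c : ℝ := ptw k W d
    let g : ℕ → ℝ := fun i => if i = (d : ℕ) then 1 - c else - c
    have hgx : ∀ y ∈ simplex k, ∑ i : Fin k, g i * y i = y d - c := by
      intro y hy
      have e : ∀ i : Fin k, g i * y i = (if i = d then y i else 0) - c * y i := by
        intro i
        simp only [g, Fin.val_inj]
        split_ifs <;> ring
      rw [Finset.sum_congr rfl fun i _ => e i, Finset.sum_sub_distrib, ← Finset.mul_sum, hy.2]
      simp
    have hgW : wt g W = 0 := by
      have h1 := hgx _ (ptw_simplex k W hWd hWne)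
      rw [wt_ptw k g W hWd] at h1
      have h2 : wt g W / W.length = 0 := by rw [h1]; exact sub_self c
      rcases div_eq_zero_iff.1 h2 with h | h
      · exact h
      · linarith
    have h1 := hg x hx hx0 g hgW
    have h2 := hg x hx hx0 (fun i => - g i) (by rw [wt_neg, hgW, neg_zero])
    simp only [neg_mul, Finset.sum_neg_distrib] at h2
    rw [hgx x hx.1] at h1 h2
    show x d = c
    linarith
  have hpt0 : ∑ i : Fin k, F i * ptw k W i = 0 := by
    rw [wt_ptw k F W hWd, h5, zero_div]
  rw [mem_extremePoints_iff_left]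
  refine ⟨pt_mem k hk2 n (r + 1), ?_⟩
  rintro x hx y hy ⟨a, b, ha, hb, hab, hxy⟩
  apply huniq x hx
  have h1 := hF x hx
  have h2 := hF y hy
  have e : ∑ i : Fin k, F i * ptw k W i =
      a * ∑ i : Fin k, F i * x i + b * ∑ i : Fin k, F i * y i := by
    rw [← hxy, Finset.mul_sum, Finset.mul_sum, ← Finset.sum_add_distrib]
    refine Finset.sum_congr rfl fun i _ => ?_
    simp only [PiLp.add_apply, PiLp.smul_apply, smul_eq_mul]
    ring
  rw [hpt0] at e
  nlinarith [mul_nonneg hb.le h2, mul_nonneg ha.le h1]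

lemma lwN_add (k : ℕ) (n : ℕ → ℕ) (a b : ℕ) (l : List ℕ) :
    lwN k n (a + b) l = lwN k n a (lwN k (tlN n a) b l) := by
  induction a generalizing n with
  | zero =>
    rw [zero_add]
    rfl
  | succ a ih =>
    have e : a + 1 + b = (a + b) + 1 := by omega
    rw [e]
    show lw k (n 0) (lwN k (tl n) (a + b) l) = lw k (n 0) (lwN k (tl n) a _)
    rw [ih (tl n)]
    have : tlN (tl n) a = tlN n (a + 1) := by
      funext r
      simp only [tlN, tl]
      congr 1
    rw [this]

lemma pt_ne (k : ℕ) (hk : 3 ≤ k) (n : ℕ → ℕ) (r s : ℕ) (hr : n r ≠ 0) (hrs : r < s) :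
    ptw k (lwN k n (r + 1) [0]) ≠ ptw k (lwN k n (s + 1) [0]) := by
  have hk2 : 2 ≤ k := by omega
  obtain ⟨F, -, -, -, h4, h5, h6⟩ := exists_F k hk r n hr
  intro heq
  have hd : ∀ j, Dig k (lwN k n j [0]) := fun j => lwN_dig k hk2 n _ _ (sing_dig k 0 (by omega))
  have h1 := wt_ptw k F _ (hd (r + 1))
  have h2 := wt_ptw k F _ (hd (s + 1))
  rw [heq, h2, h5, zero_div] at h1
  have hlen : ((lwN k n (s + 1) [0]).length : ℝ) ≠ 0 := by
    have := List.length_pos_iff.2 (lwN_ne_nil k n (s + 1) [0] (by simp))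
    positivity
  have h3 : wt F (lwN k n (s + 1) [0]) = 0 := by
    rcases div_eq_zero_iff.1 h1 with h | h
    · exact h
    · exact absurd h hlen
  obtain ⟨t, rfl⟩ : ∃ t, s = r + 1 + t := ⟨s - (r + 1), by omega⟩
  rw [add_assoc (r + 1) t 1, lwN_add, wt_lwN] at h3
  set H : ℕ → ℝ := fun i => wt F (lwN k n (r + 1) [i]) with hH
  set n' := tlN n (r + 1)
  change wt H (lw k (n' 0) (lwN k (tl n') t [0])) = 0 at h3
  have hne := lwN_ne_nil k (tl n') t [0] (by simp)
  have hHnn : ∀ i, i < k → 0 ≤ H i := by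
    intro i hi
    rcases Nat.eq_zero_or_pos i with h | h
    · rw [h]; exact h5.ge
    · exact (h6 i h hi).le
  cases hl : lwN k (tl n') t [0] with
  | nil => exact hne hl
  | cons a l =>
    obtain ⟨z, -, hz⟩ := lamWord_eq k (n' 0) a
    rw [hl, lw_cons, hz, List.cons_append, wt_cons, wt_append, wt_replicate] at h3
    have p1 := wt_nonneg k H _ (lw_dig k (n' 0) l hk2) hHnn
    have p2 : 0 ≤ (z : ℝ) * H 0 := mul_nonneg (Nat.cast_nonneg _) (hHnn 0 (by omega))
    have p3 : 0 < H (if a + 2 < k then a + 1 else k - 1) := by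
      apply h6
      · split_ifs <;> omega
      · split_ifs <;> omega
    linarith

lemma irrational_infinite (k : ℕ) (hk : 3 ≤ k) (n : ℕ → ℕ) (h : ∀ R, ∃ r, R ≤ r ∧ n r ≠ 0) :
    (Set.extremePoints ℝ (DFn k n)).Infinite := by
  have hinf : {r | n r ≠ 0}.Infinite := by
    rw [Set.infinite_iff_exists_gt]
    intro a
    obtain ⟨r, h1, h2⟩ := h (a + 1)
    exact ⟨r, h2, by omega⟩
  have hinj : Set.InjOn (fun r => ptw k (lwN k n (r + 1) [0])) {r | n r ≠ 0} := by
    intro r hr s hs heq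
    rcases lt_trichotomy r s with h1 | h1 | h1
    · exact absurd heq (pt_ne k hk n r s hr h1)
    · exact h1
    · exact absurd heq.symm (pt_ne k hk n s r hs h1)
  refine (hinf.image hinj).mono ?_
  rintro _ ⟨r, hr, rfl⟩
  exact pt_extreme k hk n r hr

/-- `DF(n)` has finitely many extreme points iff `k = 2` or `n` is of
rational type. -/
theorem stmt7 (k : ℕ) (hk : 2 ≤ k) (n : ℕ → ℕ) :
    (Set.extremePoints ℝ (DFn k n)).Finite ↔ (k = 2 ∨ ∃ R, ∀ r, R ≤ r → n r = 0) := by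
  constructor
  · intro hfin
    by_contra hc
    have h2 : k ≠ 2 := fun h => hc (Or.inl h)
    refine irrational_infinite k (by omega) n ?_ hfin
    intro R
    by_contra hn
    refine hc (Or.inr ⟨R, fun r hr => ?_⟩)
    by_contra h0
    exact hn ⟨r, hr, h0⟩
  · rintro (h | ⟨R, hR⟩)
    · subst h
      exact two_finite _ fun α hα => hα.1
    · exact rational_finite k hk n R hR

end BetaDF
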